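/- arXiv:math/0009164 — 6 statements merged into one kernel-verified Lean document; each statement's English description precedes it below -/
import Mathlib

section
/- Let K ⊆ ℝ² be a simple set, i.e. a compact set whose complement has exactly two connected components W₁ and W₂ such that the sets A₁ and A₂ of points of K accessible from W₁ and from W₂ are each dense in K. Then A₁ and A₂ are closed subsets of K with respect to the topology LC(K) (the topology on K generated by the connected components of subsets of K that are open in the subspace topology). -/
open Set Metric Topology

noncomputable section

/-- The plane `ℝ²`. -/
abbrev Plane : Type := EuclideanSpace ℝ (Fin 2)

/-- `φ` is an end-cut of the open set `U` at the point `x`: an injective continuous map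
`[0,1] → ℝ²` with `φ 0 = x` and `φ ((0,1]) ⊆ U`. -/
def IsEndCut (U : Set Plane) (x : Plane) (φ : unitInterval → Plane) : Prop :=
  Continuous φ ∧ Function.Injective φ ∧ φ 0 = x ∧
    ∀ t : unitInterval, t ≠ 0 → φ t ∈ U

/-- The point `x` (on the frontier of `U`) is accessible from `U`. -/
def Accessible (U : Set Plane) (x : Plane) : Prop :=
  x ∈ frontier U ∧ ∃ φ : unitInterval → Plane, IsEndCut U x φ

/-- `ψ` is a cross-cut of the open set `U`: an injective continuous map `[0,1] → ℝ²`
with `ψ 0, ψ 1 ∈ frontier U` and `ψ ((0,1)) ⊆ U`. -/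
def IsCrossCut (U : Set Plane) (ψ : unitInterval → Plane) : Prop :=
  Continuous ψ ∧ Function.Injective ψ ∧ ψ 0 ∈ frontier U ∧ ψ 1 ∈ frontier U ∧
    ∀ t : unitInterval, t ≠ 0 → t ≠ 1 → ψ t ∈ U

/-- `K` is a compact set whose complement has exactly two connected components
`W₁` and `W₂`. -/
def TwoSided (K W₁ W₂ : Set Plane) : Prop :=
  IsCompact K ∧ W₁ ≠ W₂ ∧
    (∃ x ∈ Kᶜ, connectedComponentIn Kᶜ x = W₁) ∧
    (∃ x ∈ Kᶜ, connectedComponentIn Kᶜ x = W₂) ∧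
    ∀ x ∈ Kᶜ, connectedComponentIn Kᶜ x = W₁ ∨ connectedComponentIn Kᶜ x = W₂

/-- The set of points of `K` accessible from `W`. -/
def AccPts (K W : Set Plane) : Set Plane := {x ∈ K | Accessible W x}

/-- `R` is sufficiently dense in `F`: for every `x ∈ F` and every open neighborhood `U`
of `x`, the connected component `F(U,x)` of `x` in `F ∩ U` meets `R`. -/
def SuffDense (F R : Set Plane) : Prop :=
  ∀ x ∈ F, ∀ U : Set Plane, IsOpen U → x ∈ U →
    (connectedComponentIn (F ∩ U) x ∩ R).Nonempty

/-- `K` is a d-set: a two-sided set such that both `A₁` and `A₂` are sufficiently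
dense in `K`. -/
def IsDSet (K W₁ W₂ : Set Plane) : Prop :=
  TwoSided K W₁ W₂ ∧ SuffDense K (AccPts K W₁) ∧ SuffDense K (AccPts K W₂)

/-- `K` is a simple set: a two-sided set such that both `A₁` and `A₂` are dense in `K`. -/
def IsSimpleSet (K W₁ W₂ : Set Plane) : Prop :=
  TwoSided K W₁ W₂ ∧ K ⊆ closure (AccPts K W₁) ∧ K ⊆ closure (AccPts K W₂)

/-- `K` is a simple closed curve: it is homeomorphic to the unit circle. -/
def IsSimpleClosedCurve (K : Set Plane) : Prop :=
  Nonempty (K ≃ₜ (Metric.sphere (0 : Plane) 1 : Set Plane))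

/-- The topology `LC(X)` generated by the connected components of open subsets of `X`. -/
def LC (X : Type*) [TopologicalSpace X] : TopologicalSpace X :=
  TopologicalSpace.generateFrom
    {C : Set X | ∃ U : Set X, IsOpen U ∧ ∃ x ∈ U, connectedComponentIn U x = C}

/-- A topological space is zero-dimensional if it has a basis of clopen sets. -/
def ZeroDimensional (X : Type*) [TopologicalSpace X] : Prop :=
  ∀ (x : X) (U : Set X), IsOpen U → x ∈ U →
    ∃ V : Set X, IsClopen V ∧ x ∈ V ∧ V ⊆ U

/-- Two continuous logarithms of the same function on a preconnected set differ by a constant. -/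
theorem sub_eq_sub_of_exp_eq_exp {S : Set ℂ} (hS : IsPreconnected S) {f g : ℂ → ℂ}
    (hf : ContinuousOn f S) (hg : ContinuousOn g S)
    (h : ∀ z ∈ S, Complex.exp (f z) = Complex.exp (g z)) {a b : ℂ} (ha : a ∈ S) (hb : b ∈ S) :
    f a - g a = f b - g b := by
  have hc : ((fun z => f z - g z) '' S).Countable := by
    refine (countable_range fun n : ℤ => (n : ℂ) * (2 * Real.pi * Complex.I)).mono ?_
    rintro _ ⟨z, hz, rfl⟩
    obtain ⟨n, hn⟩ := Complex.exp_eq_one_iff.1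
      (show Complex.exp (f z - g z) = 1 by
        rw [Complex.exp_sub, h z hz, div_self (Complex.exp_ne_zero _)])
    exact ⟨n, hn.symm⟩
  exact hc.isTotallyDisconnected _ Subset.rfl (hS.image _ (hf.sub hg))
    (mem_image_of_mem _ ha) (mem_image_of_mem _ hb)

theorem Complex.re_pos_of_norm_sub_one_lt {u : ℂ} (h : ‖u - 1‖ < 1) : 0 < u.re := by
  have := (abs_lt.1 ((Complex.abs_re_le_norm (u - 1)).trans_lt h)).1
  simp at this
  linarith

theorem Complex.re_div_sub_pos {z p q : ℂ} (h : dist p q < dist z q) :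
    0 < ((z - p) / (z - q)).re := by
  have hzq : z - q ≠ 0 := sub_ne_zero.2 fun e => by
    rw [e, dist_self] at h; exact absurd h (not_lt.2 dist_nonneg)
  refine Complex.re_pos_of_norm_sub_one_lt ?_
  rw [div_sub_one hzq, norm_div, div_lt_one (norm_pos_iff.2 hzq)]
  rw [dist_comm, dist_eq_norm, dist_eq_norm] at h
  simpa using h

theorem Complex.log_div_of_re_pos {u v : ℂ} (hu : 0 < u.re) (hv : 0 < v.re) :
    Complex.log (u / v) = Complex.log u - Complex.log v := by
  have hu0 : u ≠ 0 := fun e => by simp [e] at hu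
  have hv0 : v ≠ 0 := fun e => by simp [e] at hv
  have h1 := abs_lt.1 (Complex.abs_arg_lt_pi_div_two_iff.2 (Or.inl hu))
  have h2 := abs_lt.1 (Complex.abs_arg_lt_pi_div_two_iff.2 (Or.inl hv))
  have e : u / v = Complex.exp (Complex.log u - Complex.log v) := by
    rw [Complex.exp_sub, Complex.exp_log hu0, Complex.exp_log hv0]
  rw [e, Complex.log_exp] <;> simp only [Complex.sub_im, Complex.log_im] <;>
    linarith [h1.1, h1.2, h2.1, h2.2]

/-- The branch of `log ((z - p) / (z - q))` outside of a disc around `x` containing `p` and `q`. -/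
def outerLog (x p q z : ℂ) : ℂ :=
  Complex.log ((z - p) / (z - x)) - Complex.log ((z - q) / (z - x))

theorem outerLog_exp {x p q z : ℂ} (hp : dist p x < dist z x) (hq : dist q x < dist z x) :
    Complex.exp (outerLog x p q z) * (z - q) = z - p := by
  have h1 := Complex.re_div_sub_pos hp
  have h2 := Complex.re_div_sub_pos hq
  have hu0 : (z - p) / (z - x) ≠ 0 := fun e => by simp [e] at h1
  have hv0 : (z - q) / (z - x) ≠ 0 := fun e => by simp [e] at h2
  rw [outerLog, Complex.exp_sub, Complex.exp_log hu0, Complex.exp_log hv0]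
  have := (div_ne_zero_iff.1 hv0)
  field_simp [this.1, this.2]

theorem outerLog_continuousAt {x p q z : ℂ} (hp : dist p x < dist z x)
    (hq : dist q x < dist z x) : ContinuousAt (outerLog x p q) z := by
  have hzx : z - x ≠ 0 := sub_ne_zero.2 fun e => by
    rw [e, dist_self] at hp; exact absurd hp (not_lt.2 dist_nonneg)
  exact ((by fun_prop (disch := assumption) : ContinuousAt (fun z => (z - p) / (z - x)) z).clog
    (Or.inl (Complex.re_div_sub_pos hp))).sub
    ((by fun_prop (disch := assumption) : ContinuousAt (fun z => (z - q) / (z - x)) z).clog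
    (Or.inl (Complex.re_div_sub_pos hq)))

/-- If `p` and `q` lie in a preconnected set `E`, then `(z - p) / (z - q)` has a continuous
logarithm at positive distance from `E`, which is `outerLog` outside of discs containing `E`. -/
theorem exists_log_off_preconnected {E : Set ℂ} (hE : IsPreconnected E) {ε : ℝ} (hε : 0 < ε)
    {p q : ℂ} (hp : p ∈ E) (hq : q ∈ E) :
    ∃ L : ℂ → ℂ, ContinuousOn L {z | ∀ e ∈ E, ε ≤ dist z e} ∧
      (∀ z, (∀ e ∈ E, ε ≤ dist z e) → Complex.exp (L z) * (z - q) = z - p) ∧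
      ∀ x r, E ⊆ ball x r → ∀ z, r ≤ dist z x → L z = outerLog x p q z := by
  have near : ∀ p ∈ E, ∀ q ∈ E, dist p q < ε →
    ∃ L : ℂ → ℂ, ContinuousOn L {z | ∀ e ∈ E, ε ≤ dist z e} ∧
      (∀ z, (∀ e ∈ E, ε ≤ dist z e) → Complex.exp (L z) * (z - q) = z - p) ∧
      ∀ x r, E ⊆ ball x r → ∀ z, r ≤ dist z x → L z = outerLog x p q z := by
    intro p hp q hq hpq
    have key : ∀ z, (∀ e ∈ E, ε ≤ dist z e) → z - q ≠ 0 ∧ 0 < ((z - p) / (z - q)).re := by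
      intro z hz
      refine ⟨sub_ne_zero.2 fun e => ?_, Complex.re_div_sub_pos (hpq.trans_le (hz q hq))⟩
      have := hz q hq
      rw [e, dist_self] at this
      linarith
    refine ⟨fun z => Complex.log ((z - p) / (z - q)), ?_, ?_, ?_⟩
    · refine ContinuousOn.clog ?_ fun z hz => Or.inl (key z hz).2
      exact ContinuousOn.div (by fun_prop) (by fun_prop) fun z hz => (key z hz).1
    · intro z hz
      have h2 := (key z hz).2
      rw [Complex.exp_log fun e => by simp [e] at h2, div_mul_cancel₀ _ (key z hz).1]
    · intro x r hr z hz
      have h1 := Complex.re_div_sub_pos ((mem_ball.1 (hr hp)).trans_le hz)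
      have h2 := Complex.re_div_sub_pos ((mem_ball.1 (hr hq)).trans_le hz)
      have hv0 : (z - q) / (z - x) ≠ 0 := fun e => by simp [e] at h2
      rw [outerLog, ← Complex.log_div_of_re_pos h1 h2,
        div_div_div_cancel_right₀ (div_ne_zero_iff.1 hv0).2]
  refine hE.induction₂' (fun p q => ∃ L : ℂ → ℂ, ContinuousOn L {z | ∀ e ∈ E, ε ≤ dist z e} ∧
      (∀ z, (∀ e ∈ E, ε ≤ dist z e) → Complex.exp (L z) * (z - q) = z - p) ∧
      ∀ x r, E ⊆ ball x r → ∀ z, r ≤ dist z x → L z = outerLog x p q z) ?_ ?_ hp hq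
  · intro p hp
    filter_upwards [self_mem_nhdsWithin, mem_nhdsWithin_of_mem_nhds (ball_mem_nhds p hε)]
      with q hq hqp
    exact ⟨near p hp q hq (by rwa [dist_comm]), near q hq p hp hqp⟩
  · rintro p q s - - - ⟨L, hLc, hLe, hLo⟩ ⟨M, hMc, hMe, hMo⟩
    refine ⟨fun z => L z + M z, hLc.add hMc, fun z hz => ?_, fun x r hr z hz => ?_⟩
    · rw [Complex.exp_add, mul_assoc, hMe z hz, hLe z hz]
    · simp only [hLo x r hr z hz, hMo x r hr z hz, outerLog]
      ring

/-- `z - p` has no continuous logarithm on a circle around `p`. -/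
theorem no_log_on_circle {p : ℂ} {R : ℝ} (hR : 0 < R) {h : ℂ → ℂ} (hc : Continuous h)
    (he : ∀ z, dist z p = R → Complex.exp (h z) = z - p) : False := by
  have e0 := sub_eq_sub_of_exp_eq_exp (S := (fun t : ℝ => (t : ℂ)) '' univ)
    (isPreconnected_univ.image _ (by fun_prop))
    (f := fun t => h (p + R * Complex.exp (t.re * Complex.I)))
    (g := fun t => Real.log R + t.re * Complex.I) (a := (0 : ℝ)) (b := ((2 * Real.pi : ℝ) : ℂ))
    (by fun_prop) (by fun_prop) ?_ (mem_image_of_mem _ trivial) (mem_image_of_mem _ trivial)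
  · have : Complex.exp (2 * Real.pi * Complex.I) = 1 := Complex.exp_two_pi_mul_I
    simp [this, Real.pi_ne_zero] at e0
  · rintro _ ⟨t, -, rfl⟩
    simp only [Complex.ofReal_re]
    rw [he, Complex.exp_add, ← Complex.ofReal_exp, Real.exp_log hR]
    · ring
    · simp [Complex.norm_exp_ofReal_mul_I, abs_of_pos hR]

/-- If `(z - p) / (z - q)` has a continuous logarithm on the complement of a bounded open set `O`
containing `p` and `q`, then `p` and `q` lie in the same connected component of `O`. -/
theorem mem_connectedComponentIn_of_log {O : Set ℂ} (hO : IsOpen O)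
    (hb : Bornology.IsBounded O) {p q : ℂ} (hp : p ∈ O) {L : ℂ → ℂ}
    (hL : ContinuousOn L Oᶜ) (he : ∀ z ∈ Oᶜ, Complex.exp (L z) * (z - q) = z - p) :
    q ∈ connectedComponentIn O p := by
  classical
  by_contra hq
  set V := connectedComponentIn O p with hV
  have hVo : IsOpen V := hO.connectedComponentIn
  have hpV : p ∈ V := mem_connectedComponentIn hp
  have hVO : V ⊆ O := connectedComponentIn_subset O p
  have hfr : frontier V ⊆ Oᶜ := by
    intro z hz hzO
    have hz' : z ∉ V := by
      rw [hVo.frontier_eq] at hz; exact hz.2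
    obtain ⟨w, hw1, hw2⟩ := mem_closure_iff.1 (frontier_subset_closure hz) _
      (hO.connectedComponentIn (x := z)) (mem_connectedComponentIn hzO)
    rw [hV, connectedComponentIn_eq hw2, ← connectedComponentIn_eq hw1] at hz'
    exact hz' (mem_connectedComponentIn hzO)
  obtain ⟨Λ, hΛ⟩ := ContinuousMap.exists_restrict_eq hO.isClosed_compl
    ⟨_, continuousOn_iff_continuous_domRestrict.1 hL⟩
  have hΛ' : ∀ z ∈ Oᶜ, Λ z = L z := fun z hz => congrArg (fun f => f ⟨z, hz⟩) hΛ
  set G : ℂ → ℂ := V.piecewise (fun z => Complex.exp (Λ z) * (z - q)) (fun z => z - p) with hG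
  have hGc : Continuous G := by
    refine Continuous.piecewise (fun z hz => ?_) (by fun_prop) (by fun_prop)
    rw [hΛ' z (hfr hz), he z (hfr hz)]
  have hG0 : ∀ z, G z ≠ 0 := by
    intro z
    by_cases hz : z ∈ V
    · rw [hG, piecewise_eq_of_mem _ _ _ hz]
      exact mul_ne_zero (Complex.exp_ne_zero _) (sub_ne_zero.2 fun e => hq (e ▸ hz))
    · rw [hG, piecewise_eq_of_notMem _ _ _ hz]
      exact sub_ne_zero.2 fun e => hz (e ▸ hpV)
  obtain ⟨h, ⟨-, hh⟩, -⟩ := Complex.isCoveringMapOn_exp.existsUnique_continuousMap_lifts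
    ⟨G, hGc⟩ (Complex.exp_log (hG0 p)) hG0
  obtain ⟨R, hR⟩ := (hb.subset_ball p)
  have hR0 : 0 < R := dist_nonneg.trans_lt (mem_ball.1 (hR hp))
  refine no_log_on_circle (p := p) hR0 h.continuous fun z hz => ?_
  have hzV : z ∉ V := fun hzV => (mem_ball.1 (hR (hVO hzV))).ne hz
  have : Complex.exp (h z) = G z := congrFun hh z
  rwa [hG, piecewise_eq_of_notMem _ _ _ hzV] at this

/-- Let `W₁`, `W₂` be disjoint connected open subsets of the plane with `W₁ ∪ closure W₂` the
whole plane. Two points of `W₁` lying in a connected set that misses `W₂` and is contained in a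
disc are joined inside `W₁` within any larger concentric disc. -/
theorem mem_connectedComponentIn_inter_ball {W₁ W₂ E : Set ℂ} (h₁ : IsOpen W₁)
    (hc₁ : IsConnected W₁) (h₂ : IsOpen W₂) (hc₂ : IsPreconnected W₂) (hd : Disjoint W₁ W₂)
    (hcl : W₁ᶜ ⊆ closure W₂) (hE : IsPreconnected E) (hE₂ : Disjoint E W₂) {x : ℂ} {r R : ℝ}
    (hr : E ⊆ ball x r) (hrR : r < R) {p q : ℂ} (hpE : p ∈ E) (hqE : q ∈ E) (hp : p ∈ W₁)
    (hq : q ∈ W₁) : q ∈ connectedComponentIn (W₁ ∩ ball x R) p := by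
  classical
  -- a logarithm on the complement of `W₁`
  obtain ⟨γ, hγ⟩ := ((h₁.isConnected_iff_isPathConnected.1 hc₁).joinedIn p hp q hq)
  obtain ⟨δ, hδ, hδW⟩ := (isCompact_range γ.continuous).exists_thickening_subset_open h₁
    (range_subset_iff.2 hγ)
  have far : ∀ z ∈ W₁ᶜ, ∀ e ∈ range γ, δ ≤ dist z e := by
    intro z hz e he
    by_contra! hlt
    exact hz (hδW (mem_thickening_iff.2 ⟨e, he, hlt⟩))
  obtain ⟨L, hLc, hLe, -⟩ := exists_log_off_preconnected
    (isPreconnected_range γ.continuous) hδ ⟨0, γ.source⟩ ⟨1, γ.target⟩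
  replace hLc : ContinuousOn L W₁ᶜ := hLc.mono far
  have hLe' : ∀ z ∈ W₁ᶜ, Complex.exp (L z) * (z - q) = z - p := fun z hz => hLe z (far z hz)
  have hW₂ : W₂ ⊆ W₁ᶜ := hd.symm.subset_compl_right
  -- on `W₂`, it differs from the outer logarithm by a constant
  have hconst : ∀ w ∈ W₂, ∀ w' ∈ W₂, r ≤ dist w x → r ≤ dist w' x →
      L w - outerLog x p q w = L w' - outerLog x p q w' := by
    intro w hw w' hw' hwr hwr'
    have hpc := h₂.isConnected_iff_isPathConnected.1 ⟨⟨w, hw⟩, hc₂⟩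
    obtain ⟨σ, hσ⟩ := hpc.joinedIn w hw w' hw'
    obtain ⟨ε, hε, hεW⟩ := (isCompact_range σ.continuous).exists_thickening_subset_open h₂
      (range_subset_iff.2 hσ)
    have far₂ : ∀ z ∈ range σ, ∀ e ∈ E, ε ≤ dist z e := by
      intro z hz e he
      by_contra! hlt
      exact disjoint_left.1 hE₂ he (hεW (mem_thickening_iff.2 ⟨z, hz, by rwa [dist_comm]⟩))
    obtain ⟨M, hMc, hMe, hMo⟩ := exists_log_off_preconnected hE hε hpE hqE
    have := sub_eq_sub_of_exp_eq_exp (isPreconnected_range σ.continuous)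
      (hLc.mono ((range_subset_iff.2 hσ).trans hW₂)) (hMc.mono far₂) (fun z hz => ?_)
      ⟨0, σ.source⟩ ⟨1, σ.target⟩
    · rwa [hMo x r hr w hwr, hMo x r hr w' hwr'] at this
    · have hzW : z ∈ W₁ᶜ := hW₂ (range_subset_iff.2 hσ hz)
      have hzq : z - q ≠ 0 := sub_ne_zero.2 fun e => hzW (e ▸ hq)
      exact mul_right_cancel₀ hzq ((hLe' z hzW).trans (hMe z (far₂ z hz)).symm)
  have hpr := mem_ball.1 (hr hpE)
  have hqr := mem_ball.1 (hr hqE)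
  obtain ⟨c, hce, hc⟩ : ∃ c : ℂ, Complex.exp c = 1 ∧
      ∀ w ∈ W₂, r ≤ dist w x → L w = outerLog x p q w + c := by
    by_cases hne : ∃ w ∈ W₂, r ≤ dist w x
    · obtain ⟨w, hw, hwr⟩ := hne
      refine ⟨L w - outerLog x p q w, ?_, fun w' hw' hwr' => ?_⟩
      · have hwq : w - q ≠ 0 := sub_ne_zero.2 fun e => hW₂ hw (e ▸ hq)
        rw [Complex.exp_sub, div_eq_one_iff_eq (Complex.exp_ne_zero _)]
        exact mul_right_cancel₀ hwq ((hLe' w (hW₂ hw)).trans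
          (outerLog_exp (hpr.trans_le hwr) (hqr.trans_le hwr)).symm)
      · rw [hconst w hw w' hw' hwr hwr']; ring
    · push Not at hne
      exact ⟨0, Complex.exp_zero, fun w hw hwr => absurd hwr (not_le.2 (hne w hw))⟩
  have hc' : ∀ z ∈ W₁ᶜ, r < dist z x → L z = outerLog x p q z + c := by
    intro z hz hzr
    have hcont : ContinuousWithinAt (fun z => L z - (outerLog x p q z + c)) W₂ z :=
      ((hLc z hz).mono hW₂).sub ((outerLog_continuousAt (hpr.trans hzr)
        (hqr.trans hzr)).add continuousAt_const).continuousWithinAt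
    have hne : (𝓝[W₂] z).NeBot := mem_closure_iff_nhdsWithin_neBot.1 (hcl hz)
    refine sub_eq_zero.1 (tendsto_nhds_unique (hcont.tendsto.congr' ?_) tendsto_const_nhds :
      L z - (outerLog x p q z + c) = 0)
    filter_upwards [self_mem_nhdsWithin, mem_nhdsWithin_of_mem_nhds
      ((isOpen_lt continuous_const (continuous_id.dist continuous_const)).mem_nhds hzr)]
      with w hw hwr
    exact sub_eq_zero.2 (hc w hw hwr.le)
  -- the two logarithms glue to one on the complement of `W₁ ∩ ball x R`
  set O := W₁ ∩ ball x R
  have hO : ∀ z ∈ Oᶜ, z ∈ W₁ → R ≤ dist z x := fun z hz hz₁ => by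
    by_contra! hlt
    exact hz ⟨hz₁, hlt⟩
  set F : ℂ → ℂ := fun z => if z ∈ W₁ then outerLog x p q z + c else L z with hF
  have hFL : ∀ z ∈ W₁ᶜ, F z = L z := fun z hz => if_neg hz
  have hFo : ∀ z ∈ (ball x R)ᶜ, F z = outerLog x p q z + c := by
    intro z hz
    by_cases hz₁ : z ∈ W₁
    · exact if_pos hz₁
    · rw [hFL z hz₁, hc' z hz₁ (hrR.trans_le (not_lt.1 hz))]
  refine mem_connectedComponentIn_of_log (h₁.inter isOpen_ball)
    (isBounded_ball.subset inter_subset_right) ⟨hp, ball_subset_ball hrR.le (hr hpE)⟩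
    (L := F) ?_ ?_
  · rw [compl_inter]
    refine ContinuousOn.union_of_isClosed (hLc.congr hFL) (ContinuousOn.congr ?_ hFo)
      h₁.isClosed_compl isOpen_ball.isClosed_compl
    intro z hz
    have hzr := hrR.trans_le (not_lt.1 hz : R ≤ dist z x)
    exact ((outerLog_continuousAt (hpr.trans hzr) (hqr.trans hzr)).add
      continuousAt_const).continuousWithinAt
  · intro z hz
    by_cases hz₁ : z ∈ W₁
    · have hzr := hrR.trans_le (hO z hz hz₁)
      rw [hF]
      simp only [if_pos hz₁]
      rw [Complex.exp_add, hce, mul_one, outerLog_exp (hpr.trans hzr) (hqr.trans hzr)]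
    · rw [hFL z hz₁, hLe' z hz₁]

/-- The last point of `M` that is at most `u`. -/
def lastBefore (M : Set ℝ) (u : ℝ) : ℝ := sSup (M ∩ Iic u)

/-- The first point of `M` that is at least `u`. -/
def firstAfter (M : Set ℝ) (u : ℝ) : ℝ := sInf (M ∩ Ici u)

/-- `M` is a closed set of times outside of which all excursions of `f` are loops that may be
erased: `f` takes equal values at the two ends of every bounded gap of `M`. -/
structure IsErasure {X : Type*} (f : ℝ → X) (M : Set ℝ) : Prop where
  isClosed : IsClosed M
  iic_subset : Iic 0 ⊆ M
  ici_subset : Ici 1 ⊆ M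
  gap : ∀ s ∈ M, ∀ t ∈ M, s < t → Disjoint (Ioo s t) M → f s = f t

namespace IsErasure

variable {X : Type*} {f : ℝ → X} {M : Set ℝ}

theorem lastBefore_mem (h : IsErasure f M) (u : ℝ) : lastBefore M u ∈ M ∩ Iic u :=
  (h.isClosed.inter isClosed_Iic).csSup_mem
    ⟨min u 0, h.iic_subset (min_le_right u 0), min_le_left u 0⟩ ⟨u, fun _ hv => hv.2⟩

theorem firstAfter_mem (h : IsErasure f M) (u : ℝ) : firstAfter M u ∈ M ∩ Ici u :=
  (h.isClosed.inter isClosed_Ici).csInf_mem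
    ⟨max u 1, h.ici_subset (le_max_right u 1), le_max_left u 1⟩ ⟨u, fun _ hv => hv.2⟩

theorem le_lastBefore {m u : ℝ} (hm : m ∈ M) (hu : m ≤ u) : m ≤ lastBefore M u :=
  le_csSup ⟨u, fun _ hv => hv.2⟩ ⟨hm, hu⟩

theorem firstAfter_le {m u : ℝ} (hm : m ∈ M) (hu : u ≤ m) : firstAfter M u ≤ m :=
  csInf_le ⟨u, fun _ hv => hv.2⟩ ⟨hm, hu⟩

theorem apply_lastBefore (h : IsErasure f M) (u : ℝ) : f (lastBefore M u) = f (firstAfter M u) := by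
  obtain ⟨h1, h1'⟩ := h.lastBefore_mem u
  obtain ⟨h2, h2'⟩ := h.firstAfter_mem u
  rcases (h1'.trans h2' : lastBefore M u ≤ firstAfter M u).eq_or_lt with e | hlt
  · rw [e]
  · refine h.gap _ h1 _ h2 hlt (disjoint_left.2 fun m hm hmM => ?_)
    rcases le_total m u with hu | hu
    · exact absurd (le_lastBefore hmM hu) (not_le.2 hm.1)
    · exact absurd (firstAfter_le hmM hu) (not_le.2 hm.2)

theorem lastBefore_mono (h : IsErasure f M) {u v : ℝ} (huv : u ≤ v) :
    lastBefore M u ≤ lastBefore M v :=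
  le_lastBefore (h.lastBefore_mem u).1 ((h.lastBefore_mem u).2.trans huv)

theorem lastBefore_of_mem (h : IsErasure f M) {u : ℝ} (hu : u ∈ M) : lastBefore M u = u :=
  le_antisymm (h.lastBefore_mem u).2 (le_lastBefore hu le_rfl)

theorem lastBefore_eq_of_le (h : IsErasure f M) {u w : ℝ} (huw : u ≤ w) (hle : lastBefore M w ≤ u) :
    lastBefore M w = lastBefore M u :=
  le_antisymm (le_lastBefore (h.lastBefore_mem w).1 hle) (h.lastBefore_mono huw)

/-- Erasing all the loops of a continuous path leaves a continuous path. -/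
theorem continuous_comp_lastBefore [MetricSpace X] (h : IsErasure f M) (hf : Continuous f) :
    Continuous fun u => f (lastBefore M u) := by
  refine continuous_iff_continuousAt.2 fun t => ?_
  by_cases ht : t ∈ M
  · have hc : Filter.Tendsto (fun u => if t ≤ u then lastBefore M u else firstAfter M u)
        (𝓝 t) (𝓝 t) := by
      refine tendsto_iff_dist_tendsto_zero.2 (squeeze_zero (fun _ => dist_nonneg) (fun u => ?_)
        (tendsto_iff_dist_tendsto_zero.1 Filter.tendsto_id : Filter.Tendsto
          (fun u : ℝ => dist u t) (𝓝 t) (𝓝 0)))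
      split_ifs with hu
      · have h1 : lastBefore M u ≤ u := (h.lastBefore_mem u).2
        have h2 := le_lastBefore ht hu
        rw [Real.dist_eq, Real.dist_eq, abs_of_nonneg (by linarith), abs_of_nonneg (by linarith)]
        linarith
      · have h1 : u ≤ firstAfter M u := (h.firstAfter_mem u).2
        have h2 := firstAfter_le ht (not_le.1 hu).le
        rw [Real.dist_eq, Real.dist_eq, abs_of_nonpos (by linarith), abs_of_nonpos (by linarith)]
        linarith
    have := (hf.tendsto t).comp hc
    rw [ContinuousAt, h.lastBefore_of_mem ht]
    refine this.congr fun u => ?_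
    simp only [Function.comp_apply]
    split_ifs
    · rfl
    · exact (h.apply_lastBefore u).symm
  · refine (continuousAt_const (y := f (lastBefore M t))).congr ?_
    filter_upwards [h.isClosed.isOpen_compl.mem_nhds ht,
      Ioo_mem_nhds ((h.lastBefore_mem t).2.lt_of_ne fun e => ht (e ▸ (h.lastBefore_mem t).1))
        ((h.firstAfter_mem t).2.lt_of_ne fun e => ht (e ▸ (h.firstAfter_mem t).1))]
      with u _ hu
    have hut : lastBefore M u ≤ t := by
      by_contra! hlt
      exact absurd ((firstAfter_le (h.lastBefore_mem u).1 hlt.le).trans (h.lastBefore_mem u).2)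
        (not_le.2 hu.2)
    exact congrArg f (le_antisymm (le_lastBefore (h.lastBefore_mem t).1 hu.1.le)
      (le_lastBefore (h.lastBefore_mem u).1 hut))

theorem sInter [MetricSpace X] (hf : Continuous f) {c : Set (Set ℝ)}
    (hc : ∀ M ∈ c, IsErasure f M) (hchain : IsChain (· ⊆ ·) c) (hne : c.Nonempty) :
    IsErasure f (⋂₀ c) where
  isClosed := isClosed_sInter fun M hM => (hc M hM).isClosed
  iic_subset := subset_sInter fun M hM => (hc M hM).iic_subset
  ici_subset := subset_sInter fun M hM => (hc M hM).ici_subset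
  gap s hs t ht hst hd := by
    refine eq_of_forall_dist_le fun ε hε => ?_
    obtain ⟨δ₁, hδ₁, h₁⟩ :=
      Metric.continuousAt_iff.1 (hf.continuousAt (x := s)) (ε / 2) (half_pos hε)
    obtain ⟨δ₂, hδ₂, h₂⟩ :=
      Metric.continuousAt_iff.1 (hf.continuousAt (x := t)) (ε / 2) (half_pos hε)
    set δ := min (min δ₁ δ₂) ((t - s) / 2) with hδ
    have hδ0 : 0 < δ := lt_min (lt_min hδ₁ hδ₂) (by linarith)
    have hle₁ : δ ≤ δ₁ := (min_le_left _ _).trans (min_le_left _ _)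
    have hle₂ : δ ≤ δ₂ := (min_le_left _ _).trans (min_le_right _ _)
    have hle : δ ≤ (t - s) / 2 := min_le_right _ _
    have : Nonempty c := hne.to_subtype
    obtain ⟨⟨M, hM⟩, hMd⟩ := (isCompact_Icc (a := s + δ) (b := t - δ)).elim_directed_family_closed
      (fun M : c => M.1) (fun M => (hc _ M.2).isClosed)
      (by
        rw [← sInter_eq_iInter, ← disjoint_iff_inter_eq_empty]
        exact hd.mono_left (Icc_subset_Ioo (by linarith) (by linarith)))
      (by
        intro A B
        rcases hchain.total A.2 B.2 with hAB | hAB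
        · exact ⟨A, subset_rfl, hAB⟩
        · exact ⟨B, hAB, subset_rfl⟩)
    have hE := hc M hM
    set m := (s + t) / 2 with hm
    have hl1 : s ≤ lastBefore M m := le_lastBefore (hs M hM) (by linarith)
    have hl2 : lastBefore M m < s + δ := by
      by_contra! hlt
      have : lastBefore M m ≤ m := (hE.lastBefore_mem m).2
      exact (hMd ▸ notMem_empty _ : lastBefore M m ∉ Icc (s + δ) (t - δ) ∩ M)
        ⟨⟨hlt, by linarith⟩, (hE.lastBefore_mem m).1⟩
    have hr1 : firstAfter M m ≤ t := firstAfter_le (ht M hM) (by linarith)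
    have hr2 : t - δ < firstAfter M m := by
      by_contra! hlt
      have : m ≤ firstAfter M m := (hE.firstAfter_mem m).2
      exact (hMd ▸ notMem_empty _ : firstAfter M m ∉ Icc (s + δ) (t - δ) ∩ M)
        ⟨⟨by linarith, hlt⟩, (hE.firstAfter_mem m).1⟩
    have e1 := h₁ (x := lastBefore M m)
      (by rw [Real.dist_eq, abs_of_nonneg (by linarith)]; linarith)
    have e2 := h₂ (x := firstAfter M m)
      (by rw [Real.dist_eq, abs_of_nonpos (by linarith)]; linarith)
    rw [← hE.apply_lastBefore] at e2
    rw [dist_comm] at e1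
    linarith [dist_triangle (f s) (f (lastBefore M m)) (f t)]

theorem exists_minimal [MetricSpace X] (hf : Continuous f) :
    ∃ M, Minimal (· ∈ {M | IsErasure f M}) M := by
  refine (zorn_superset_nonempty {M | IsErasure f M} (fun c hc hchain hne =>
    ⟨⋂₀ c, sInter hf hc hchain hne, fun _ hs => sInter_subset_of_mem hs⟩) univ ?_).imp
    fun _ h => h.2
  refine ⟨isClosed_univ, subset_univ _, subset_univ _, fun s _ t _ hst hd => ?_⟩
  exact absurd hd (not_disjoint_iff.2 ⟨_, (nonempty_Ioo.2 hst).some_mem, trivial⟩)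

theorem disjoint_of_minimal (h : Minimal (· ∈ {M | IsErasure f M}) M) {s t : ℝ} (hs : s ∈ M)
    (ht : t ∈ M) (hs0 : 0 ≤ s) (ht1 : t ≤ 1) (hf : f s = f t) :
    Disjoint (Ioo s t) M := by
  have hM : IsErasure f M := h.1
  have hE : IsErasure f (M \ Ioo s t) := by
    refine ⟨hM.isClosed.sdiff isOpen_Ioo, fun u hu => ⟨hM.iic_subset hu, fun hu' => ?_⟩,
      fun u hu => ⟨hM.ici_subset hu, fun hu' => ?_⟩, fun a ha b hb hab hd => ?_⟩
    · exact absurd (hs0.trans_lt hu'.1) (not_lt.2 hu)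
    · exact absurd (hu'.2.trans_le ht1) (not_lt.2 hu)
    · have same : Disjoint (Ioo a b) (Ioo s t) → f a = f b := fun hd' =>
        hM.gap a ha.1 b hb.1 hab (disjoint_left.2 fun u hu huM =>
          disjoint_left.1 hd hu ⟨huM, disjoint_left.1 hd' hu⟩)
      rcases le_or_gt t a with hta | hat
      · exact same (disjoint_left.2 fun u hu hu' => absurd (hu'.2.trans_le hta) hu.1.not_gt)
      rcases le_or_gt b s with hbs | hsb
      · exact same (disjoint_left.2 fun u hu hu' => absurd (hu.2.trans_le hbs) hu'.1.not_gt)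
      have has : a ≤ s := by
        by_contra! hlt
        exact ha.2 ⟨hlt, hat⟩
      have htb : t ≤ b := by
        by_contra! hlt
        exact hb.2 ⟨hsb, hlt⟩
      have ea : a = s := by
        by_contra hne
        exact disjoint_left.1 hd ⟨has.lt_of_ne hne, hsb⟩ ⟨hs, fun hu => lt_irrefl _ hu.1⟩
      have eb : t = b := by
        by_contra hne
        exact disjoint_left.1 hd ⟨hat, htb.lt_of_ne hne⟩ ⟨ht, fun hu => lt_irrefl _ hu.2⟩
      rw [ea, ← eb, hf]
  exact disjoint_left.2 fun u hu huM => (h.2 hE sdiff_subset huM).2 hu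

/-- After a maximal loop erasure a path only returns to a point if it has not left it. -/
theorem apply_lastBefore_of_minimal (h : Minimal (· ∈ {M | IsErasure f M}) M) {u v w : ℝ}
    (hu : 0 ≤ u) (hv : v ≤ 1) (huv : f (lastBefore M u) = f (lastBefore M v)) (huw : u ≤ w)
    (hwv : w ≤ v) : f (lastBefore M w) = f (lastBefore M u) := by
  have hM : IsErasure f M := h.1
  rcases le_or_gt (lastBefore M w) u with hw | hw
  · rw [hM.lastBefore_eq_of_le huw hw]
  have h1 := firstAfter_le (hM.lastBefore_mem w).1 hw.le
  have h2 := hM.lastBefore_mono hwv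
  rcases h1.eq_or_lt with e1 | l1
  · rw [← e1, ← hM.apply_lastBefore]
  rcases h2.eq_or_lt with e2 | l2
  · rw [e2, huv]
  · have := disjoint_of_minimal h (hM.firstAfter_mem u).1 (hM.lastBefore_mem v).1
      (hu.trans (hM.firstAfter_mem u).2) ((hM.lastBefore_mem v).2.trans hv)
      (by rw [← hM.apply_lastBefore, huv])
    exact absurd (hM.lastBefore_mem w).1 (disjoint_left.1 this ⟨l1, l2⟩)

end IsErasure

/-- The farthest that `g` gets from `g q` during the times from `q` to `t`, truncated at `1`. -/
def excursion {X : Type*} [MetricSpace X] (g : ℝ → X) (q t : ℝ) : ℝ :=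
  sSup ((fun a => min 1 (dist (g a) (g q))) '' Icc q (max q t))

section excursion

variable {X : Type*} [MetricSpace X] {g : ℝ → X} {q t u v : ℝ}

theorem excursion_bddAbove (g : ℝ → X) (q t : ℝ) :
    BddAbove ((fun a => min 1 (dist (g a) (g q))) '' Icc q (max q t)) :=
  ⟨1, by rintro _ ⟨a, -, rfl⟩; exact min_le_left _ _⟩

theorem excursion_nonempty (g : ℝ → X) (q t : ℝ) :
    ((fun a => min 1 (dist (g a) (g q))) '' Icc q (max q t)).Nonempty :=
  (nonempty_Icc.2 (le_max_left q t)).image _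

theorem excursion_le_one : excursion g q t ≤ 1 :=
  csSup_le (excursion_nonempty g q t) (by rintro _ ⟨a, -, rfl⟩; exact min_le_left _ _)

theorem le_excursion {a : ℝ} (ha : a ∈ Icc q (max q t)) :
    min 1 (dist (g a) (g q)) ≤ excursion g q t :=
  le_csSup (excursion_bddAbove g q t) (mem_image_of_mem _ ha)

theorem excursion_nonneg : 0 ≤ excursion g q t :=
  (le_min zero_le_one dist_nonneg).trans (le_excursion (left_mem_Icc.2 (le_max_left q t)))

theorem excursion_mono (huv : u ≤ v) : excursion g q u ≤ excursion g q v :=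
  csSup_le_csSup (excursion_bddAbove g q v) (excursion_nonempty g q u)
    (image_mono (Icc_subset_Icc_right (max_le_max_left q huv)))

theorem excursion_eq_zero (h : t ≤ q) : excursion g q t = 0 := by
  simp [excursion, max_eq_left h]

theorem excursion_continuous (hg : Continuous g) : Continuous (excursion g q) := by
  have : excursion g q = fun t => sSup ((fun s =>
      min 1 (dist (g (q + s * (max q t - q))) (g q))) '' Icc (0 : ℝ) 1) := by
    ext t
    have hI : Icc q (max q t) = (fun s => q + s * (max q t - q)) '' Icc (0 : ℝ) 1 := by
      have := segment_eq_image ℝ q (max q t)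
      rw [segment_eq_Icc (le_max_left _ _)] at this
      rw [this]
      refine image_congr fun s _ => ?_
      simp only [smul_eq_mul]; ring
    rw [excursion, hI, image_image]
  rw [this]
  exact isCompact_Icc.continuous_sSup
    (f := fun t s => min 1 (dist (g (q + s * (max q t - q))) (g q))) (by fun_prop)

/-- The excursions do not grow while `g` stands still. -/
theorem excursion_eq_of_const (huv : u ≤ v) (h : ∀ w ∈ Icc u v, g w = g u) :
    excursion g q u = excursion g q v := by
  refine le_antisymm (excursion_mono huv) (csSup_le (excursion_nonempty g q v) ?_)
  rintro _ ⟨a, ha, rfl⟩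
  by_cases hau : a ≤ max q u
  · exact le_excursion ⟨ha.1, hau⟩
  · have hlt := max_lt_iff.1 (not_le.1 hau)
    have hav : a ≤ v := (le_max_iff.1 ha.2).resolve_left (not_le.2 hlt.1)
    simp only [h a ⟨hlt.2.le, hav⟩]
    rcases le_total q u with hq | hq
    · exact le_excursion ⟨hq, le_max_right q u⟩
    · rw [h q ⟨hq, hlt.1.le.trans hav⟩, dist_self]
      exact (min_le_right _ _).trans excursion_nonneg

end excursion

/-- A path that only returns to a point if it has not left it can be reparametrized to an
injective path. -/
theorem exists_injective_of_monotone_light {X : Type*} [MetricSpace X] {g : ℝ → X}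
    (hg : Continuous g)
    (hm : ∀ u v w, 0 ≤ u → v ≤ 1 → u ≤ w → w ≤ v → g u = g v → g w = g u) (h01 : g 0 ≠ g 1) :
    ∃ φ : unitInterval → X, Continuous φ ∧ Function.Injective φ ∧ φ 0 = g 0 ∧ φ 1 = g 1 ∧
      ∀ t, ∃ u ∈ Icc (0 : ℝ) 1, φ t = g u := by
  obtain ⟨ε, hε, c, hc, -⟩ := posSumOfEncodable one_pos ℚ
  set h : ℝ → ℝ := fun t => ∑' q : ℚ, ε q * excursion g q t with hh
  have hle : ∀ t (q : ℚ), ε q * excursion g q t ≤ ε q := fun t q =>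
    mul_le_of_le_one_right (hε q).le excursion_le_one
  have hnn : ∀ t (q : ℚ), 0 ≤ ε q * excursion g q t := fun t q =>
    mul_nonneg (hε q).le excursion_nonneg
  have hsum : ∀ t, Summable fun q : ℚ => ε q * excursion g q t := fun t =>
    hc.summable.of_nonneg_of_le (hnn t) (hle t)
  have hcont : Continuous h := continuous_tsum
    (fun q => continuous_const.mul (excursion_continuous hg)) hc.summable
    (fun q t => by rw [Real.norm_of_nonneg (hnn t q)]; exact hle t q)
  have hmono : Monotone h := fun u v huv => (hsum u).tsum_le_tsum
    (fun q => mul_le_mul_of_nonneg_left (excursion_mono huv) (hε q).le) (hsum v)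
  have hlt : ∀ u v, u < v → g u ≠ g v → h u < h v := by
    intro u v huv hne
    have hopen : {w | g w ≠ g v} ∈ 𝓝[>] u := mem_nhdsWithin_of_mem_nhds
      ((isOpen_ne_fun hg continuous_const).mem_nhds hne)
    obtain ⟨b, hb, hbs⟩ := (mem_nhdsGT_iff_exists_Ioo_subset' huv).1 hopen
    obtain ⟨q, huq, hq⟩ := exists_rat_btwn (lt_min huv hb)
    have hqv : (q : ℝ) < v := hq.trans_le (min_le_left _ _)
    have hgq : g q ≠ g v := hbs ⟨huq, hq.trans_le (min_le_right _ _)⟩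
    refine Summable.tsum_lt_tsum (i := q)
      (fun q => mul_le_mul_of_nonneg_left (excursion_mono huv.le) (hε q).le) ?_ (hsum u) (hsum v)
    refine mul_lt_mul_of_pos_left ?_ (hε q)
    rw [excursion_eq_zero huq.le]
    exact (lt_min one_pos (dist_pos.2 hgq.symm)).trans_le
      (le_excursion ⟨hqv.le, le_max_right _ _⟩)
  have heq : ∀ u ∈ Icc (0 : ℝ) 1, ∀ v ∈ Icc (0 : ℝ) 1, u ≤ v → g u = g v → h u = h v := by
    intro u hu v hv huv huv'
    exact tsum_congr fun q => congrArg _ (excursion_eq_of_const huv fun w hw =>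
      hm u v w hu.1 hv.2 hw.1 hw.2 huv')
  have heq' : ∀ u ∈ Icc (0 : ℝ) 1, ∀ v ∈ Icc (0 : ℝ) 1, g u = g v → h u = h v := by
    intro u hu v hv huv'
    rcases le_total u v with huv | huv
    · exact heq u hu v hv huv huv'
    · exact (heq v hv u hu huv huv'.symm).symm
  have hinv : ∀ u v, h u = h v → g u = g v := by
    intro u v huv
    by_contra hne
    rcases lt_trichotomy u v with hl | hl | hl
    · exact (hlt u v hl hne).ne huv
    · exact hne (hl ▸ rfl)
    · exact (hlt v u hl (Ne.symm hne)).ne huv.symm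
  have h0 : 0 < h 1 - h 0 := sub_pos.2 (hlt 0 1 one_pos h01)
  have hsurj : ∀ y : unitInterval, ∃ u ∈ Icc (0 : ℝ) 1, h u = h 0 + y * (h 1 - h 0) := by
    intro y
    refine intermediate_value_Icc zero_le_one hcont.continuousOn ⟨?_, ?_⟩
    · exact le_add_of_nonneg_right (mul_nonneg y.2.1 h0.le)
    · have := mul_le_of_le_one_left h0.le y.2.2
      linarith
  choose k hkI hk using hsurj
  let H : unitInterval → unitInterval := fun u => ⟨(h u - h 0) / (h 1 - h 0),
    div_nonneg (sub_nonneg.2 (hmono u.2.1)) h0.le,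
    (div_le_one h0).2 (sub_le_sub_right (hmono u.2.2) _)⟩
  have hH : Continuous H := by fun_prop
  have hHk : ∀ u, h (k (H u)) = h u := by
    intro u
    rw [hk]
    simp only [H]
    field_simp
    ring
  have hHs : Function.Surjective H := fun y => ⟨⟨k y, hkI y⟩, Subtype.ext (by
    simp only [H, hk]
    field_simp
    ring)⟩
  refine ⟨fun y => g (k y), ?_, fun y y' hy => ?_, hinv _ _ ?_, hinv _ _ ?_,
    fun y => ⟨k y, hkI y, rfl⟩⟩
  · rw [(hH.isClosedMap.isQuotientMap hH hHs).continuous_iff]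
    have : (fun y => g (k y)) ∘ H = fun u : unitInterval => g u :=
      funext fun u => hinv _ _ (hHk u)
    rw [this]
    exact hg.comp continuous_subtype_val
  · have := heq' _ (hkI y) _ (hkI y') hy
    rw [hk, hk] at this
    exact Subtype.ext (mul_right_cancel₀ h0.ne' (add_left_cancel this))
  · rw [hk]; simp
  · rw [hk]; simp

/-- A path between two distinct points of a metric space contains an arc between them. -/
theorem exists_injective_path {X : Type*} [MetricSpace X] {f : ℝ → X} (hf : Continuous f)
    (h01 : f 0 ≠ f 1) :
    ∃ φ : unitInterval → X, Continuous φ ∧ Function.Injective φ ∧ φ 0 = f 0 ∧ φ 1 = f 1 ∧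
      ∀ t, ∃ u ∈ Icc (0 : ℝ) 1, φ t = f u := by
  obtain ⟨M, hM⟩ := IsErasure.exists_minimal hf
  have hE : IsErasure f M := hM.1
  have e0 : lastBefore M 0 = 0 := hE.lastBefore_of_mem (hE.iic_subset (mem_Iic.2 le_rfl))
  have e1 : lastBefore M 1 = 1 := hE.lastBefore_of_mem (hE.ici_subset (mem_Ici.2 le_rfl))
  obtain ⟨φ, hc, hi, hφ0, hφ1, hφ⟩ := exists_injective_of_monotone_light
    (hE.continuous_comp_lastBefore hf)
    (fun u v w hu hv huw hwv huv => IsErasure.apply_lastBefore_of_minimal hM hu hv huv huw hwv)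
    (by rwa [e0, e1])
  refine ⟨φ, hc, hi, by rw [hφ0, e0], by rw [hφ1, e1], fun t => ?_⟩
  obtain ⟨u, hu, hut⟩ := hφ t
  refine ⟨lastBefore M u, ⟨?_, (hE.lastBefore_mem u).2.trans hu.2⟩, hut⟩
  exact IsErasure.le_lastBefore (hE.iic_subset (mem_Iic.2 le_rfl)) hu.1

/-- Infinitely many paths that are joined end to end and shrink to a point `x` concatenate to a
path starting at `x`. -/
theorem exists_path_of_joinedIn {X : Type*} [MetricSpace X] {x : X} {U : ℕ → Set X} {p : ℕ → X}
    {r : ℕ → ℝ} (hj : ∀ n, JoinedIn (U n) (p n) (p (n + 1))) (hU : ∀ n, U n ⊆ ball x (r n))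
    (hr : Filter.Tendsto r Filter.atTop (𝓝 0)) :
    ∃ f : ℝ → X, Continuous f ∧ f 0 = x ∧ ∀ t, 0 < t → ∃ n, f t ∈ U n := by
  choose γ hγ using hj
  let g : ℝ → X := fun t => (γ ⌊t⌋₊).extend (t - ⌊t⌋₊)
  have hgU : ∀ t, g t ∈ U ⌊t⌋₊ := fun t => hγ _ _
  have hgn : ∀ n : ℕ, ∀ t ∈ Icc (n : ℝ) (n + 1), g t = (γ n).extend (t - n) := by
    intro n t ht
    have hfl : ∀ m : ℕ, ⌊t⌋₊ = m → g t = (γ m).extend (t - m) := by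
      rintro m rfl
      rfl
    rcases ht.2.eq_or_lt with e | hlt
    · rw [hfl (n + 1) (by rw [e]; exact_mod_cast Nat.floor_natCast (n + 1)), e]
      simp
    · exact hfl n ((Nat.floor_eq_iff (n.cast_nonneg.trans ht.1)).2 ⟨ht.1, hlt⟩)
  have hgc : ∀ n : ℕ, ContinuousOn g (Icc 0 n) := by
    intro n
    induction n with
    | zero => simp
    | succ n ih =>
      have hI : Icc (0 : ℝ) (n + 1 : ℕ) = Icc 0 (n : ℝ) ∪ Icc (n : ℝ) (n + 1) := by
        rw [Icc_union_Icc_eq_Icc n.cast_nonneg (by linarith)]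
        push_cast
        rfl
      rw [hI]
      exact ih.union_of_isClosed (ContinuousOn.congr (by fun_prop) (hgn n)) isClosed_Icc
        isClosed_Icc
  have hgat : ∀ t, 0 < t → ContinuousAt g t := by
    intro t ht
    obtain ⟨n, hn⟩ := exists_nat_gt t
    exact (hgc n).continuousAt (Icc_mem_nhds ht hn)
  set f : ℝ → X := fun t => if t ≤ 0 then x else g t⁻¹ with hf
  have hfpos : ∀ t, 0 < t → f t = g t⁻¹ := fun t ht => if_neg (not_le.2 ht)
  have hfneg : ∀ t, t ≤ 0 → f t = x := fun t ht => if_pos ht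
  refine ⟨f, continuous_iff_continuousAt.2 fun t => ?_, hfneg 0 le_rfl, fun t ht => ?_⟩
  · rcases lt_trichotomy t 0 with ht | rfl | ht
    · refine (continuousAt_const (y := x)).congr ?_
      filter_upwards [Iio_mem_nhds ht] with u hu
      exact (hfneg u (le_of_lt hu)).symm
    · refine continuousAt_iff_continuous_left'_right'.2 ⟨?_, ?_⟩
      · refine (continuousWithinAt_const (b := x)).congr (fun u hu => hfneg u (le_of_lt hu))
          (hfneg 0 le_rfl)
      · have hlim : Filter.Tendsto g Filter.atTop (𝓝 x) :=
          tendsto_iff_dist_tendsto_zero.2 (squeeze_zero (fun _ => dist_nonneg)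
            (fun t => (mem_ball.1 (hU _ (hgU t))).le) (hr.comp tendsto_nat_floor_atTop))
        rw [ContinuousWithinAt, hfneg 0 le_rfl]
        refine (hlim.comp tendsto_inv_nhdsGT_zero).congr' ?_
        filter_upwards [self_mem_nhdsWithin] with u hu
        exact (hfpos u hu).symm
    · refine ((hgat _ (inv_pos.2 ht)).comp (continuousAt_inv₀ ht.ne')).congr ?_
      filter_upwards [Ioi_mem_nhds ht] with u hu
      exact (hfpos u hu).symm
  · exact ⟨_, hfpos t ht ▸ hgU t⁻¹⟩

/-- The version of `mem_connectedComponentIn_inter_ball` for `Plane`. -/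
theorem joinedIn_inter_ball {W₁ W₂ E : Set Plane} (h₁ : IsOpen W₁)
    (hc₁ : IsConnected W₁) (h₂ : IsOpen W₂) (hc₂ : IsPreconnected W₂) (hd : Disjoint W₁ W₂)
    (hcl : W₁ᶜ ⊆ closure W₂) (hE : IsPreconnected E) (hE₂ : Disjoint E W₂) {x : Plane} {r R : ℝ}
    (hr : E ⊆ ball x r) (hrR : r < R) {p q : Plane} (hpE : p ∈ E) (hqE : q ∈ E) (hp : p ∈ W₁)
    (hq : q ∈ W₁) : JoinedIn (W₁ ∩ ball x R) p q := by
  let e : Plane ≃ₗᵢ[ℝ] ℂ := Complex.orthonormalBasisOneI.repr.symm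
  have hball : ∀ s, e '' ball x s = ball (e x) s := fun s => e.image_ball x s
  have hpO : p ∈ W₁ ∩ ball x R := ⟨hp, ball_subset_ball hrR.le (hr hpE)⟩
  have key := mem_connectedComponentIn_inter_ball (e.toHomeomorph.isOpen_image.2 h₁)
    (hc₁.image _ e.continuous.continuousOn) (e.toHomeomorph.isOpen_image.2 h₂)
    (hc₂.image _ e.continuous.continuousOn) ((disjoint_image_iff e.injective).2 hd)
    (by
      have := image_mono (f := e) hcl
      rwa [image_compl_eq e.bijective, ← e.coe_toHomeomorph, e.toHomeomorph.image_closure] at this)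
    (hE.image _ e.continuous.continuousOn) ((disjoint_image_iff e.injective).2 hE₂)
    (hball r ▸ image_mono hr) hrR (mem_image_of_mem e hpE) (mem_image_of_mem e hqE)
    (mem_image_of_mem e hp) (mem_image_of_mem e hq)
  have himg := e.toHomeomorph.image_connectedComponentIn hpO
  rw [e.coe_toHomeomorph, image_inter e.injective, hball] at himg
  have hq' : q ∈ connectedComponentIn (W₁ ∩ ball x R) p := by
    rw [← e.injective.mem_set_image, himg]
    exact key
  have hO : IsOpen (W₁ ∩ ball x R) := h₁.inter isOpen_ball
  have hpc := hO.connectedComponentIn.isConnected_iff_isPathConnected.1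
    (isConnected_connectedComponentIn_iff.2 hpO)
  exact (hpc.joinedIn p (mem_connectedComponentIn hpO) q hq').mono
    (connectedComponentIn_subset _ _)

/-- A point `x` is accessible from `W₁` if in each disc around `x` it is connected, off `W₂`, to a
point of `W₁`. -/
theorem accessible_of_preconnected {W₁ W₂ : Set Plane} (h₁ : IsOpen W₁)
    (hc₁ : IsConnected W₁) (h₂ : IsOpen W₂) (hc₂ : IsPreconnected W₂) (hd : Disjoint W₁ W₂)
    (hcl : W₁ᶜ ⊆ closure W₂) {x : Plane} (hx : x ∈ frontier W₁)
    (h : ∀ r > 0, ∃ E, IsPreconnected E ∧ x ∈ E ∧ E ⊆ ball x r ∧ Disjoint E W₂ ∧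
      (E ∩ W₁).Nonempty) : Accessible W₁ x := by
  refine ⟨hx, ?_⟩
  have hxW : x ∉ W₁ := by
    rw [h₁.frontier_eq] at hx
    exact hx.2
  choose E hE hxE hEr hE₂ p hp using fun n : ℕ => h (1 / ((n : ℝ) + 1)) (by positivity)
  obtain ⟨f, hfc, hf0, hf⟩ := exists_path_of_joinedIn (x := x) (p := p)
    (U := fun n : ℕ => W₁ ∩ ball x (1 / ((n : ℝ) + 1) + 1 / ((n : ℝ) + 1)))
    (r := fun n : ℕ => 1 / ((n : ℝ) + 1) + 1 / ((n : ℝ) + 1))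
    (fun n => by
      have hle : 1 / (((n + 1 : ℕ) : ℝ) + 1) ≤ 1 / ((n : ℝ) + 1) :=
        one_div_le_one_div_of_le (by positivity) (by push_cast; linarith)
      have hpos : 0 < 1 / ((n : ℝ) + 1) := by positivity
      exact joinedIn_inter_ball h₁ hc₁ h₂ hc₂ hd hcl
        ((hE n).union x (hxE n) (hxE (n + 1)) (hE (n + 1)))
        (disjoint_union_left.2 ⟨hE₂ n, hE₂ (n + 1)⟩)
        (union_subset (hEr n) ((hEr (n + 1)).trans (ball_subset_ball hle)))
        (by linarith) (Or.inl (hp n).1) (Or.inr (hp (n + 1)).1) (hp n).2 (hp (n + 1)).2)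
    (fun n => inter_subset_right)
    (by
      have := tendsto_one_div_add_atTop_nhds_zero_nat (𝕜 := ℝ)
      simpa using this.add this)
  have hfW : ∀ t, 0 < t → f t ∈ W₁ := fun t ht => (hf t ht).choose_spec.1
  obtain ⟨φ, hφc, hφi, hφ0, -, hφ⟩ := exists_injective_path hfc
    (fun e => hxW (hf0 ▸ e ▸ hfW 1 one_pos))
  refine ⟨φ, hφc, hφi, hφ0.trans hf0, fun t ht => ?_⟩
  obtain ⟨u, hu, hut⟩ := hφ t
  rcases hu.1.eq_or_lt with rfl | hpos
  · exact absurd (hφi (hut.trans hφ0.symm)) ht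
  · exact hut ▸ hfW u hpos

theorem TwoSided.symm {K W₁ W₂ : Set Plane} (h : TwoSided K W₁ W₂) : TwoSided K W₂ W₁ :=
  ⟨h.1, h.2.1.symm, h.2.2.2.1, h.2.2.1, fun x hx => (h.2.2.2.2 x hx).symm⟩

/-- Near an accessible point, the initial piece of an end-cut is a connected set reaching into the
domain. -/
theorem Accessible.exists_preconnected {W : Set Plane} {a : Plane} (h : Accessible W a)
    {U : Set Plane} (hU : IsOpen U) (ha : a ∈ U) :
    ∃ S, IsPreconnected S ∧ a ∈ S ∧ S ⊆ U ∧ S ⊆ insert a W ∧ (S ∩ W).Nonempty := by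
  obtain ⟨-, φ, hc, -, h0, hW⟩ := h
  have hnhds : φ ⁻¹' U ∈ 𝓝 0 := (hU.preimage hc).mem_nhds (by rwa [mem_preimage, h0])
  obtain ⟨ε, hε, hεU⟩ := Metric.mem_nhds_iff.1 hnhds
  let t : unitInterval := ⟨min (ε / 2) 1, le_min (half_pos hε).le zero_le_one, min_le_right _ _⟩
  have ht0 : t ≠ 0 := fun e => (lt_min (half_pos hε) one_pos).ne' (congrArg Subtype.val e)
  refine ⟨φ '' Icc 0 t, isPreconnected_Icc.image _ hc.continuousOn,
    ⟨0, left_mem_Icc.2 t.2.1, h0⟩, ?_, ?_, φ t, ⟨t, right_mem_Icc.2 t.2.1, rfl⟩, hW t ht0⟩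
  · rintro _ ⟨s, hs, rfl⟩
    refine hεU ?_
    rw [mem_ball, Subtype.dist_eq, Real.dist_eq]
    have h1 : (s : ℝ) ≤ min (ε / 2) 1 := hs.2
    have h2 : (0 : ℝ) ≤ s := s.2.1
    have h3 := min_le_left (ε / 2) 1
    rw [Set.Icc.coe_zero, sub_zero, abs_of_nonneg h2]
    linarith
  · rintro _ ⟨s, -, rfl⟩
    by_cases hs : s = 0
    · exact Or.inl (by rw [hs, h0])
    · exact Or.inr (hW s hs)

theorem AccPts_subset_frontier (K W : Set Plane) : AccPts K W ⊆ frontier W := fun _ hx => hx.2.1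

theorem isClosed_LC_accPts_left {K W₁ W₂ : Set Plane} (h : IsSimpleSet K W₁ W₂) :
    @IsClosed ↥K (LC ↥K) (Subtype.val ⁻¹' AccPts K W₁) := by
  obtain ⟨⟨hK, hne, ⟨w₁, hw₁, e₁⟩, ⟨w₂, hw₂, e₂⟩, hcov⟩, hd₁, hd₂⟩ := h
  have hKo : IsOpen Kᶜ := hK.isClosed.isOpen_compl
  have h₁ : IsOpen W₁ := e₁ ▸ hKo.connectedComponentIn
  have h₂ : IsOpen W₂ := e₂ ▸ hKo.connectedComponentIn
  have hc₁ : IsConnected W₁ := e₁ ▸ isConnected_connectedComponentIn_iff.2 hw₁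
  have hc₂ : IsPreconnected W₂ := e₂ ▸ isPreconnected_connectedComponentIn
  have hK₂ : Disjoint K W₂ :=
    disjoint_compl_right.mono_right (e₂ ▸ connectedComponentIn_subset Kᶜ w₂)
  have hd : Disjoint W₁ W₂ := by
    refine disjoint_left.2 fun z hz₁ hz₂ => hne ?_
    rw [← e₁] at hz₁
    rw [← e₂] at hz₂
    rw [← e₁, ← e₂, connectedComponentIn_eq hz₁, connectedComponentIn_eq hz₂]
  have hK₁ : K ⊆ frontier W₁ :=
    hd₁.trans (closure_minimal (AccPts_subset_frontier K W₁) isClosed_frontier)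
  have hcl : W₁ᶜ ⊆ closure W₂ := by
    intro z hz
    by_cases hzK : z ∈ K
    · exact frontier_subset_closure
        (hd₂.trans (closure_minimal (AccPts_subset_frontier K W₂) isClosed_frontier) hzK)
    · have hzc := mem_connectedComponentIn (F := Kᶜ) hzK
      rcases hcov z hzK with e | e
      · exact absurd (e ▸ hzc) hz
      · exact subset_closure (e ▸ hzc)
  refine @IsClosed.mk _ (LC K) _ ((@isOpen_iff_forall_mem_open _ (LC K) _).2 fun x hx => ?_)
  by_contra! hcon
  refine hx ⟨x.2, accessible_of_preconnected h₁ hc₁ h₂ hc₂ hd hcl (hK₁ x.2) fun r hr => ?_⟩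
  let U : Set K := Subtype.val ⁻¹' ball (x : Plane) r
  have hxU : x ∈ U := mem_ball_self hr
  have hUo : IsOpen U := isOpen_ball.preimage continuous_subtype_val
  have hCsub : ¬ connectedComponentIn U x ⊆ (Subtype.val ⁻¹' AccPts K W₁)ᶜ := fun hsub =>
    hcon _ hsub (TopologicalSpace.isOpen_generateFrom_of_mem ⟨U, hUo, x, hxU, rfl⟩)
      (mem_connectedComponentIn hxU)
  obtain ⟨a, haC, ha⟩ := not_subset.1 hCsub
  have ha' : (a : Plane) ∈ AccPts K W₁ := not_not.1 ha
  have haU : (a : Plane) ∈ ball (x : Plane) r := connectedComponentIn_subset U x haC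
  obtain ⟨S, hS, haS, hSU, hSW, hSne⟩ := ha'.2.exists_preconnected isOpen_ball haU
  refine ⟨Subtype.val '' connectedComponentIn U x ∪ S,
    IsPreconnected.union (a : Plane) (mem_image_of_mem _ haC) haS
      (isPreconnected_connectedComponentIn.image _ continuous_subtype_val.continuousOn) hS,
    Or.inl (mem_image_of_mem _ (mem_connectedComponentIn hxU)),
    union_subset (image_subset_iff.2 (connectedComponentIn_subset U x)) hSU,
    disjoint_union_left.2 ⟨hK₂.mono_left (Subtype.coe_image_subset _ _), ?_⟩,
    hSne.mono (inter_subset_inter_left _ subset_union_right)⟩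
  refine disjoint_left.2 fun z hz hz₂ => ?_
  rcases hSW hz with rfl | hz₁
  · exact disjoint_left.1 hK₂ a.2 hz₂
  · exact disjoint_left.1 hd hz₁ hz₂

/-- **Theorem 3.2.** Let `K` be a simple set in the plane. Then the sets `A₁` and `A₂`
of accessible points are closed in the topology `LC(K)`. -/
theorem accPts_isClosed_LC (K W₁ W₂ : Set Plane) (h : IsSimpleSet K W₁ W₂) :
    @IsClosed ↥K (LC ↥K) (Subtype.val ⁻¹' AccPts K W₁) ∧
    @IsClosed ↥K (LC ↥K) (Subtype.val ⁻¹' AccPts K W₂) :=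
  ⟨isClosed_LC_accPts_left h, isClosed_LC_accPts_left ⟨h.1.symm, h.2.2, h.2.1⟩⟩
end
end

section
/- Let K ⊆ ℝ² be a simple set with complementary domains W₁, W₂, let x ∈ K and ε > 0, and let y₁ ≠ y₂ be two points of the connected component K(closure(B(x,ε)), x) of x in K ∩ closure(B(x,ε)) that are accessible from W₁, with end-cuts α₁, α₂ : [0,1] → ℝ² of W₁ at y₁ and y₂ respectively. Then for every ε₁ > ε there exists a cross-cut β : [0,1] → ℝ² of W₁ with end-points y₁ and y₂ such that (i) β([0,1]) ⊆ B(x,ε₁), and (ii) there exist τ₁, τ₂ ∈ (0,1) with α₁([0,τ₁]) ⊆ β([0,1]) and α₂([0,τ₂]) ⊆ β([0,1]). -/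
open Set Metric Topology

noncomputable section

open Complex in
/-- On a preconnected set, two continuous functions with the same exponential differ by a
constant. -/
theorem sub_eq_sub_of_exp_eq {X : Type*} [TopologicalSpace X] {S : Set X} (hS : IsPreconnected S)
    {f g : X → ℂ} (hf : ContinuousOn f S) (hg : ContinuousOn g S)
    (hfg : ∀ z ∈ S, exp (f z) = exp (g z)) {p q : X} (hp : p ∈ S) (hq : q ∈ S) :
    f p - g p = f q - g q := by
  have key : S.EqOn f (fun z => g z + (f p - g p)) := by
    refine isCoveringMap_exp.eqOn_of_comp_eqOn hS hf (hg.add continuousOn_const) ?_ hp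
      (by ring)
    intro z hz
    apply Subtype.ext
    simp [exp_add, exp_sub, hfg z hz, hfg p hp]
  have := key hq
  simp only at this
  rw [this]
  ring

/-- `g` is a continuous logarithm of `z ↦ (z - a) / (z - b)` on the set `A`. -/
def IsLogRatio (a b : ℂ) (g : ℂ → ℂ) (A : Set ℂ) : Prop :=
  ContinuousOn g A ∧ ∀ z ∈ A, (z - b) * Complex.exp (g z) = z - a

theorem IsLogRatio.mono {a b : ℂ} {g : ℂ → ℂ} {A B : Set ℂ} (h : IsLogRatio a b g B)
    (hAB : A ⊆ B) : IsLogRatio a b g A :=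
  ⟨h.1.mono hAB, fun z hz => h.2 z (hAB hz)⟩

theorem IsLogRatio.sub_eq_sub {a b : ℂ} {f g : ℂ → ℂ} {S : Set ℂ} (hS : IsPreconnected S)
    (hb : b ∉ S) (hf : IsLogRatio a b f S) (hg : IsLogRatio a b g S) {p q : ℂ} (hp : p ∈ S)
    (hq : q ∈ S) : f p - g p = f q - g q := by
  refine sub_eq_sub_of_exp_eq hS hf.1 hg.1 (fun z hz => ?_) hp hq
  have hzb : z - b ≠ 0 := sub_ne_zero.2 (ne_of_mem_of_not_mem hz hb)
  exact mul_left_cancel₀ hzb ((hf.2 z hz).trans (hg.2 z hz).symm)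

/-- If `a` and `b` lie in a preconnected set disjoint from the closed set `A`, then
`(z - a) / (z - b)` has a continuous logarithm on `A`. -/
theorem exists_isLogRatio {S A : Set ℂ} (hS : IsPreconnected S) (hA : IsClosed A)
    (hSA : Disjoint S A) {a b : ℂ} (ha : a ∈ S) (hb : b ∈ S) : ∃ g, IsLogRatio a b g A := by
  refine hS.induction₂ (fun a b => ∃ g, IsLogRatio a b g A) ?_ ?_ ?_ ha hb
  · intro c hc
    obtain ⟨r, hr, hrA⟩ := Metric.isOpen_iff.1 hA.isOpen_compl c (disjoint_left.1 hSA hc)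
    filter_upwards [mem_nhdsWithin_of_mem_nhds (ball_mem_nhds c hr), self_mem_nhdsWithin]
      with d hd hdS
    have hne : ∀ z ∈ A, z - d ≠ 0 := fun z hz =>
      sub_ne_zero.2 (ne_of_mem_of_not_mem hz (disjoint_left.1 hSA hdS))
    have hne' : ∀ z ∈ A, z - c ≠ 0 := fun z hz =>
      sub_ne_zero.2 (ne_of_mem_of_not_mem hz (disjoint_left.1 hSA hc))
    have hslit : ∀ z ∈ A, (z - d) / (z - c) ∈ Complex.slitPlane := by
      intro z hz
      have h1 : r ≤ ‖z - c‖ := by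
        by_contra! hlt
        exact hrA (mem_ball_iff_norm.2 hlt) hz
      have h2 : ‖d - c‖ < r := mem_ball_iff_norm.1 hd
      have h3 : (z - d) / (z - c) = 1 + (-((d - c) / (z - c))) := by
        field_simp [hne' z hz]
        ring
      rw [h3]
      apply Complex.mem_slitPlane_of_norm_lt_one
      rw [norm_neg, norm_div, div_lt_one (by linarith)]
      linarith
    refine ⟨fun z => -Complex.log ((z - d) / (z - c)), ?_, fun z hz => ?_⟩
    · refine (ContinuousOn.clog ?_ hslit).neg
      exact (by fun_prop : ContinuousOn (fun z : ℂ => z - d) A).div (by fun_prop) hne'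
    · rw [Complex.exp_neg, Complex.exp_log (div_ne_zero (hne z hz) (hne' z hz)), inv_div,
        mul_div_cancel₀ _ (hne z hz)]
  · rintro u v w - - - ⟨f, hf, hf'⟩ ⟨g, hg, hg'⟩
    refine ⟨fun z => f z + g z, hf.add hg, fun z hz => ?_⟩
    rw [Complex.exp_add, ← hf' z hz, ← hg' z hz]
    ring
  · rintro u v - - ⟨f, hf, hf'⟩
    refine ⟨fun z => -f z, hf.neg, fun z hz => ?_⟩
    rw [Complex.exp_neg, ← hf' z hz, mul_inv_cancel_right₀ (Complex.exp_ne_zero _)]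

/-- There is no continuous logarithm of `z ↦ z - a` defined near infinity. -/
theorem not_exp_eq_sub_of_continuous {G : ℂ → ℂ} (hG : Continuous G) (a : ℂ) {R : ℝ}
    (hR : 0 < R) : ∃ z, R ≤ ‖z - a‖ ∧ Complex.exp (G z) ≠ z - a := by
  by_contra! hcon
  let c : ℝ → ℂ := fun θ => a + R * Complex.exp (θ * Complex.I)
  have hc : Continuous c := by fun_prop
  have key := sub_eq_sub_of_exp_eq (S := univ) isPreconnected_univ
    (f := fun θ : ℝ => G (c θ)) (g := fun θ : ℝ => Real.log R + θ * Complex.I)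
    (by fun_prop) (by fun_prop) (fun θ _ => ?_) (mem_univ 0) (mem_univ (2 * Real.pi))
  · have h0 : c (2 * Real.pi) = c 0 := by simp [c, Complex.exp_two_pi_mul_I]
    rw [h0] at key
    have : (2 * Real.pi * Complex.I : ℂ) = 0 := by
      push_cast at key
      linear_combination key
    exact Complex.two_pi_I_ne_zero this
  · rw [hcon]
    · simp only [c, add_sub_cancel_left, Complex.exp_add, ← Complex.ofReal_exp, Real.exp_log hR]
    · simp [c, abs_of_pos hR]

/-- If `(z - a) / (z - b)` has a continuous logarithm on a closed set containing the frontier of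
the bounded set `P`, then `P` does not separate `a` from `b`. -/
theorem IsLogRatio.mem_of_frontier_subset {a b : ℂ} {g : ℂ → ℂ} {E P : Set ℂ}
    (hg : IsLogRatio a b g E) (hE : IsClosed E) (hPE : frontier P ⊆ E)
    (hP : Bornology.IsBounded P) (ha : a ∈ P) : b ∈ P := by
  classical
  by_contra hb
  obtain ⟨G, hG⟩ := ContinuousMap.exists_restrict_eq hE ⟨E.domRestrict g, hg.1.domRestrict⟩
  have hGE : ∀ z ∈ E, G z = g z := fun z hz => DFunLike.congr_fun hG ⟨z, hz⟩
  let h : ℂ → ℂ := P.piecewise (fun z => (z - b) * Complex.exp (G z)) (fun z => z - a)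
  have hh : Continuous h := by
    refine Continuous.piecewise (fun z hz => ?_) (by fun_prop) (by fun_prop)
    rw [hGE z (hPE hz), hg.2 z (hPE hz)]
  have h0 : ∀ z, h z ≠ 0 := by
    intro z
    by_cases hz : z ∈ P
    · simp only [h, piecewise_eq_of_mem _ _ _ hz]
      exact mul_ne_zero (sub_ne_zero.2 (ne_of_mem_of_not_mem hz hb)) (Complex.exp_ne_zero _)
    · simp only [h, piecewise_eq_of_notMem _ _ _ hz]
      exact sub_ne_zero.2 (ne_of_mem_of_not_mem ha hz).symm
  obtain ⟨L, ⟨-, hL⟩, -⟩ := Complex.isCoveringMapOn_exp.existsUnique_continuousMap_lifts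
    ⟨h, hh⟩ (Complex.exp_log (h0 0)) (fun z => h0 z)
  obtain ⟨R, hR, hPR⟩ := hP.subset_ball_lt 0 a
  obtain ⟨z, hz, hz'⟩ := not_exp_eq_sub_of_continuous L.continuous a hR
  apply hz'
  have hzP : z ∉ P := fun hzP => (mem_ball_iff_norm.1 (hPR hzP)).not_ge hz
  have h1 := congr_fun hL z
  simpa [h, piecewise_eq_of_notMem _ _ _ hzP] using h1

theorem Complex.isPreconnected_compl_ball (c : ℂ) {r : ℝ} (hr : 0 < r) :
    IsPreconnected (ball c r)ᶜ := by
  have h : (ball c r)ᶜ = (fun w => c + Complex.exp w) '' {w | Real.log r ≤ w.re} := by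
    ext z
    simp only [mem_compl_iff, mem_ball_iff_norm, not_lt, mem_image, mem_ofPred_eq]
    constructor
    · intro hz
      have hz0 : z - c ≠ 0 := norm_pos_iff.1 (hr.trans_le hz)
      refine ⟨Complex.log (z - c), ?_, by rw [Complex.exp_log hz0]; ring⟩
      rw [Complex.log_re]
      exact Real.log_le_log hr hz
    · rintro ⟨w, hw, rfl⟩
      rw [add_sub_cancel_left, Complex.norm_exp]
      exact (Real.log_le_iff_le_exp hr).1 hw
  rw [h]
  exact (convex_halfSpace_re_ge _).isPreconnected.image _ (by fun_prop)

/-- The frontier of a component of an open set is disjoint from the set. -/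
theorem frontier_connectedComponentIn_subset_compl {X : Type*} [TopologicalSpace X]
    [LocallyConnectedSpace X] {U : Set X} (hU : IsOpen U) (a : X) :
    frontier (connectedComponentIn U a) ⊆ Uᶜ := by
  intro z hz hzU
  rw [hU.connectedComponentIn.frontier_eq] at hz
  obtain ⟨w, hw, hw'⟩ := mem_closure_iff.1 hz.1 _ hU.connectedComponentIn
    (mem_connectedComponentIn hzU)
  apply hz.2
  rw [connectedComponentIn_eq hw', ← connectedComponentIn_eq hw]
  exact mem_connectedComponentIn hzU

/-- Let `W₁`, `W₂` be disjoint connected open sets with `W₁ᶜ ⊆ closure W₂`, and `T` a connected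
subset of a disc `ball c r` missing `W₂`. Then points of `T ∩ W₁` lie in the same component of the
intersection of `W₁` with any larger disc. -/
theorem Complex.mem_connectedComponentIn_inter_ball {W₁ W₂ T : Set ℂ} (hW₁ : IsOpen W₁)
    (hW₂ : IsOpen W₂) (hc₁ : IsPreconnected W₁) (hc₂ : IsConnected W₂) (hd : Disjoint W₁ W₂)
    (hcl : W₁ᶜ ⊆ closure W₂) (hT : IsPreconnected T) (hTW : Disjoint T W₂)
    {c : ℂ} {r R : ℝ} (hr : 0 < r) (hrR : r < R) (hTr : T ⊆ ball c r) {a b : ℂ}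
    (haT : a ∈ T) (hbT : b ∈ T) (ha : a ∈ W₁) (hb : b ∈ W₁) :
    b ∈ connectedComponentIn (W₁ ∩ ball c R) a := by
  classical
  obtain ⟨f, hf⟩ := exists_isLogRatio hc₁ hW₁.isClosed_compl disjoint_compl_right ha hb
  have hTD : Disjoint T (ball c r)ᶜ := disjoint_compl_right.mono_left hTr
  obtain ⟨g, hg⟩ := exists_isLogRatio hT isOpen_ball.isClosed_compl hTD haT hbT
  have hW₂₁ : W₂ ⊆ W₁ᶜ := hd.subset_compl_left
  have hW : ∀ p ∈ W₂ ∩ (ball c r)ᶜ, ∀ q ∈ W₂ ∩ (ball c r)ᶜ, f p - g p = f q - g q := by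
    rintro p ⟨hp, hp'⟩ q ⟨hq, hq'⟩
    obtain ⟨γ, hγ⟩ := (hW₂.isConnected_iff_isPathConnected.1 hc₂).joinedIn p hp q hq
    have hγW : range γ ⊆ W₂ := range_subset_iff.2 hγ
    obtain ⟨k, hk⟩ := exists_isLogRatio (A := (ball c r)ᶜ ∪ range γ) hT
      (isOpen_ball.isClosed_compl.union (isCompact_range γ.continuous).isClosed)
      (hTD.union_right (hTW.mono_right hγW)) haT hbT
    have h1 := hg.sub_eq_sub (Complex.isPreconnected_compl_ball c hr)
      (fun h => h (hTr hbT)) (hk.mono subset_union_left) hp' hq'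
    have h2 := (hf.mono (hγW.trans hW₂₁)).sub_eq_sub (isPreconnected_range γ.continuous)
      (fun h => hd.le_bot ⟨hb, hγW h⟩) (hk.mono subset_union_right) ⟨0, γ.source⟩ ⟨1, γ.target⟩
    linear_combination h2 - h1
  obtain ⟨k, hk1, hk⟩ : ∃ k, Complex.exp k = 1 ∧ ∀ p ∈ W₂ ∩ (ball c r)ᶜ, f p - g p = k := by
    rcases (W₂ ∩ (ball c r)ᶜ).eq_empty_or_nonempty with h | ⟨q, hq⟩
    · exact ⟨0, by simp [h]⟩
    · refine ⟨_, ?_, fun p hp => hW p hp q hq⟩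
      have hqb : q - b ≠ 0 := sub_ne_zero.2 (ne_of_mem_of_not_mem hbT (fun h => hq.2 (hTr h))).symm
      rw [Complex.exp_sub, div_eq_one_iff_eq (Complex.exp_ne_zero _)]
      exact mul_left_cancel₀ hqb ((hf.2 q (hW₂₁ hq.1)).trans (hg.2 q hq.2).symm)
  have hfg : ∀ p ∈ W₁ᶜ ∩ (ball c R)ᶜ, f p = g p + k := by
    rintro p ⟨hp, hp'⟩
    have hpr : p ∈ (closedBall c r)ᶜ := fun h => hp' (closedBall_subset_ball hrR h)
    have hsub : (closedBall c r)ᶜ ⊆ (ball c r)ᶜ := compl_subset_compl.2 ball_subset_closedBall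
    have hpS : p ∈ closure ((closedBall c r)ᶜ ∩ W₂) :=
      isClosed_closedBall.isOpen_compl.inter_closure ⟨hpr, hcl hp⟩
    have hcont : ContinuousWithinAt (fun z => f z - g z) ((closedBall c r)ᶜ ∩ W₂) p :=
      ((hf.1 p hp).mono (inter_subset_right.trans hW₂₁)).sub
        ((hg.1 p (hsub hpr)).mono (inter_subset_left.trans hsub))
    have := mem_closure_iff_nhdsWithin_neBot.1 hpS
    have hlim : Filter.Tendsto (fun z => f z - g z) (𝓝[(closedBall c r)ᶜ ∩ W₂] p) (𝓝 k) :=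
      tendsto_const_nhds.congr' (eventually_nhdsWithin_of_forall
        fun z hz => (hk z ⟨hz.2, hsub hz.1⟩).symm)
    linear_combination tendsto_nhds_unique hcont.tendsto hlim
  let F : ℂ → ℂ := (W₁ᶜ).piecewise f (fun z => g z + k)
  have hF1 : EqOn F f W₁ᶜ := piecewise_eqOn _ _ _
  have hF2 : EqOn F (fun z => g z + k) (ball c R)ᶜ := by
    intro z hz
    by_cases hz1 : z ∈ W₁ᶜ
    · exact (hF1 hz1).trans (hfg z ⟨hz1, hz⟩)
    · exact piecewise_eq_of_notMem _ _ _ hz1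
  have hRr : (ball c R)ᶜ ⊆ (ball c r)ᶜ := compl_subset_compl.2 (ball_subset_ball hrR.le)
  have hE : IsClosed (W₁ᶜ ∪ (ball c R)ᶜ) := hW₁.isClosed_compl.union isOpen_ball.isClosed_compl
  have hF : IsLogRatio a b F (W₁ᶜ ∪ (ball c R)ᶜ) := by
    refine ⟨ContinuousOn.union_of_isClosed (hf.1.congr hF1)
      (((hg.1.mono hRr).add continuousOn_const).congr hF2) hW₁.isClosed_compl
      isOpen_ball.isClosed_compl, ?_⟩
    rintro z (hz | hz)
    · rw [hF1 hz, hf.2 z hz]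
    · rw [hF2 hz, Complex.exp_add, hk1, mul_one, hg.2 z (hRr hz)]
  refine hF.mem_of_frontier_subset hE ?_ ?_ ?_
  · rw [← compl_inter]
    exact frontier_connectedComponentIn_subset_compl (hW₁.inter isOpen_ball) a
  · exact isBounded_ball.subset ((connectedComponentIn_subset _ _).trans inter_subset_right)
  · exact mem_connectedComponentIn ⟨ha, ball_subset_ball hrR.le (hTr haT)⟩

/-- The planar version of `Complex.mem_connectedComponentIn_inter_ball`. -/
theorem Plane.mem_connectedComponentIn_inter_ball {W₁ W₂ T : Set Plane} (hW₁ : IsOpen W₁)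
    (hW₂ : IsOpen W₂) (hc₁ : IsPreconnected W₁) (hc₂ : IsConnected W₂) (hd : Disjoint W₁ W₂)
    (hcl : W₁ᶜ ⊆ closure W₂) (hT : IsPreconnected T) (hTW : Disjoint T W₂)
    {c : Plane} {r R : ℝ} (hr : 0 < r) (hrR : r < R) (hTr : T ⊆ ball c r) {a b : Plane}
    (haT : a ∈ T) (hbT : b ∈ T) (ha : a ∈ W₁) (hb : b ∈ W₁) :
    b ∈ connectedComponentIn (W₁ ∩ ball c R) a := by
  let e : Plane ≃ₗᵢ[ℝ] ℂ := Complex.orthonormalBasisOneI.repr.symm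
  have key := Complex.mem_connectedComponentIn_inter_ball (W₁ := e '' W₁) (W₂ := e '' W₂)
    (T := e '' T) (c := e c) (a := e a) (b := e b)
    (e.toHomeomorph.isOpenMap _ hW₁) (e.toHomeomorph.isOpenMap _ hW₂)
    (hc₁.image _ e.continuous.continuousOn) (hc₂.image _ e.continuous.continuousOn)
    ((disjoint_image_iff e.injective).2 hd)
    (by
      rw [← image_compl_eq e.bijective]
      exact (image_mono hcl).trans (e.toHomeomorph.image_closure W₂).subset)
    (hT.image _ e.continuous.continuousOn) ((disjoint_image_iff e.injective).2 hTW) hr hrR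
    (by
      rw [← e.image_ball]
      exact image_mono hTr)
    (mem_image_of_mem e haT) (mem_image_of_mem e hbT) (mem_image_of_mem e ha)
    (mem_image_of_mem e hb)
  have hab : a ∈ W₁ ∩ ball c R := ⟨ha, ball_subset_ball hrR.le (hTr haT)⟩
  rw [← e.image_ball, ← image_inter e.injective] at key
  have himg := e.toHomeomorph.image_connectedComponentIn hab
  change e '' _ = connectedComponentIn (e '' _) (e a) at himg
  rw [← himg] at key
  exact (e.injective.mem_set_image).1 key

/-- `S` is an arc with end-points `p` and `q`. -/
def IsArc {X : Type*} [TopologicalSpace X] (S : Set X) (p q : X) : Prop :=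
  ∃ γ : Path p q, Function.Injective γ ∧ range γ = S

namespace IsArc

variable {X : Type*} [TopologicalSpace X] {S T : Set X} {p q r : X}

theorem symm (h : IsArc S p q) : IsArc S q p := by
  obtain ⟨γ, hγ, rfl⟩ := h
  exact ⟨γ.symm, hγ.comp unitInterval.symm_bijective.injective, γ.symm_range⟩

theorem trans (hS : IsArc S p q) (hT : IsArc T q r) (hST : S ∩ T ⊆ {q}) :
    IsArc (S ∪ T) p r := by
  obtain ⟨γ, hγ, rfl⟩ := hS
  obtain ⟨δ, hδ, rfl⟩ := hT
  refine ⟨γ.trans δ, ?_, γ.trans_range δ⟩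
  have cross : ∀ u v, γ u = δ v → u = 1 ∧ v = 0 := by
    intro u v huv
    have hq : γ u = q := hST ⟨mem_range_self u, huv ▸ mem_range_self v⟩
    exact ⟨hγ (hq.trans γ.target.symm), hδ ((huv.symm.trans hq).trans δ.source.symm)⟩
  intro s t hst
  rw [Path.trans_apply, Path.trans_apply] at hst
  split_ifs at hst with hs ht ht
  · have := congrArg Subtype.val (hγ hst)
    ext
    simpa using this
  · have := congrArg Subtype.val (cross _ _ hst).2
    simp only [Set.Icc.coe_zero] at this
    linarith
  · have := congrArg Subtype.val (cross _ _ hst.symm).2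
    simp only [Set.Icc.coe_zero] at this
    linarith
  · have := congrArg Subtype.val (hδ hst)
    ext
    simpa using this

/-- An initial segment of an injectively parametrized arc is an arc. -/
theorem image_Icc {f : unitInterval → X} (hf : Continuous f) (hf' : Function.Injective f)
    {t : unitInterval} (ht : t ≠ 0) : IsArc (f '' Icc 0 t) (f 0) (f t) := by
  refine ⟨⟨⟨fun s => f (t * s), by fun_prop⟩, by simp, by simp⟩, ?_, ?_⟩
  · intro u v huv
    have h1 := congrArg Subtype.val (hf' huv)
    ext
    have ht' : (t : ℝ) ≠ 0 := fun h => ht (Subtype.ext h)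
    simpa [ht'] using h1
  · ext z
    constructor
    · rintro ⟨s, rfl⟩
      exact ⟨t * s, ⟨unitInterval.nonneg', unitInterval.mul_le_left⟩, rfl⟩
    · rintro ⟨s, hs, rfl⟩
      have htpos : (0 : ℝ) < t := unitInterval.pos_iff_ne_zero.2 ht
      refine ⟨⟨s / t, div_nonneg s.2.1 htpos.le, (div_le_one htpos).2 hs.2⟩, ?_⟩
      change f (t * ⟨s / t, _⟩) = f s
      congr 1
      ext
      simp [mul_div_cancel₀, htpos.ne']

/-- The part of an arc from `p ∉ F` to its first point in the closed set `F`. -/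
theorem exists_first_hit (hS : IsArc S p q) {F : Set X} (hF : IsClosed F) (hp : p ∉ F)
    (hq : q ∈ F) : ∃ q' ∈ F, ∃ S' ⊆ S, IsArc S' p q' ∧ S' ∩ F ⊆ {q'} := by
  obtain ⟨γ, hγ, rfl⟩ := hS
  obtain ⟨t, htF, ht⟩ := (hF.preimage γ.continuous).isCompact.exists_isLeast
    ⟨1, by simpa using hq⟩
  have ht0 : t ≠ 0 := by
    rintro rfl
    exact hp (by simpa using htF)
  refine ⟨γ t, htF, γ '' Icc 0 t, image_subset_range _ _, ?_, ?_⟩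
  · simpa using image_Icc γ.continuous hγ ht0
  · rintro _ ⟨⟨s, hs, rfl⟩, hsF⟩
    rw [le_antisymm hs.2 (ht hsF)]
    rfl

end IsArc

section NormedSpace

variable {E : Type*} [NormedAddCommGroup E] [NormedSpace ℝ E]

theorem isArc_segment {p q : E} (hpq : p ≠ q) : IsArc (segment ℝ p q) p q := by
  refine ⟨⟨⟨fun t => AffineMap.lineMap p q (t : ℝ), by fun_prop⟩, by simp, by simp⟩, ?_, ?_⟩
  · intro s t hst
    exact Subtype.ext (AffineMap.lineMap_injective ℝ hpq hst)
  · rw [segment_eq_image_lineMap, image_eq_range]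
    rfl

/-- An arc in `V` to one point of a closed convex subset `D` of `V` can be modified into an arc
in `V` to any other point of `D`. -/
theorem eq_or_exists_isArc_of_convex {V D : Set E} (hD : Convex ℝ D) (hDc : IsClosed D)
    (hDV : D ⊆ V) {a w v : E} (hw : w ∈ D) (hv : v ∈ D)
    (h : w = a ∨ ∃ S ⊆ V, IsArc S a w) : v = a ∨ ∃ S ⊆ V, IsArc S a v := by
  refine or_iff_not_imp_left.2 fun hva => ?_
  by_cases haD : a ∈ D
  · exact ⟨_, (hD.segment_subset haD hv).trans hDV, isArc_segment (Ne.symm hva)⟩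
  obtain ⟨S, hSV, hS⟩ := h.resolve_left (ne_of_mem_of_not_mem hw haD)
  obtain ⟨q, hq, S', hS', hS'q, hS'D⟩ := hS.exists_first_hit hDc haD hw
  rcases eq_or_ne q v with rfl | hqv
  · exact ⟨S', hS'.trans hSV, hS'q⟩
  · have hseg := hD.segment_subset hq hv
    exact ⟨_, union_subset (hS'.trans hSV) (hseg.trans hDV), hS'q.trans (isArc_segment hqv)
      ((inter_subset_inter_right _ hseg).trans hS'D)⟩

/-- Two distinct points of a connected open set are the end-points of an arc in that set. -/
theorem IsOpen.exists_isArc {V : Set E} (hV : IsOpen V) (hc : IsPreconnected V) {a b : E}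
    (ha : a ∈ V) (hb : b ∈ V) (hab : a ≠ b) : ∃ S ⊆ V, IsArc S a b := by
  have key : (a = a ∨ ∃ S ⊆ V, IsArc S a a) → b = a ∨ ∃ S ⊆ V, IsArc S a b := by
    refine hc.induction₂' (fun u v => (u = a ∨ ∃ S ⊆ V, IsArc S a u) →
      v = a ∨ ∃ S ⊆ V, IsArc S a v) (fun u hu => ?_) (fun _ _ _ _ _ _ h h' => h' ∘ h) ha hb
    obtain ⟨r, hr, hrV⟩ := nhds_basis_closedBall.mem_iff.1 (hV.mem_nhds hu)
    filter_upwards [mem_nhdsWithin_of_mem_nhds (closedBall_mem_nhds u hr)] with v hv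
    have hu' := mem_closedBall_self (x := u) hr.le
    exact ⟨eq_or_exists_isArc_of_convex (convex_closedBall u r) isClosed_closedBall hrV hu' hv,
      eq_or_exists_isArc_of_convex (convex_closedBall u r) isClosed_closedBall hrV hv hu'⟩
  exact (key (Or.inl rfl)).resolve_left hab.symm

/-- Two disjoint arcs with end-points in a connected open set `V` can be truncated and joined
through `V` to form a single arc. -/
theorem exists_isArc_of_endpoints_mem {V : Set E} (hV : IsOpen V) (hc : IsPreconnected V)
    {f g : unitInterval → E} (hf : Continuous f) (hf' : Function.Injective f)
    (hg : Continuous g) (hg' : Function.Injective g) {s t : unitInterval}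
    (hd : Disjoint (f '' Icc 0 s) (g '' Icc 0 t)) (hfs : f s ∈ V) (hgt : g t ∈ V)
    (hf0 : f 0 ∉ V) (hg0 : g 0 ∉ V) :
    ∃ S ⊆ V ∪ (f '' Icc 0 s ∪ g '' Icc 0 t), IsArc S (f 0) (g 0) ∧
      ∃ s' t', s' ≠ 0 ∧ s' ≤ s ∧ t' ≠ 0 ∧ t' ≤ t ∧ f '' Icc 0 s' ⊆ S ∧ g '' Icc 0 t' ⊆ S := by
  have hFc : IsClosed (f '' Icc 0 s) := (isCompact_Icc.image hf).isClosed
  have hGc : IsClosed (g '' Icc 0 t) := (isCompact_Icc.image hg).isClosed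
  have hfF : f s ∈ f '' Icc 0 s := mem_image_of_mem f ⟨unitInterval.nonneg', le_rfl⟩
  have hgG : g t ∈ g '' Icc 0 t := mem_image_of_mem g ⟨unitInterval.nonneg', le_rfl⟩
  obtain ⟨S₀, hS₀V, hS₀⟩ := hV.exists_isArc hc hgt hfs (hd.ne_of_mem hfF hgG).symm
  obtain ⟨_, ⟨s', hs', rfl⟩, S₁, hS₁, hS₁', hS₁F⟩ :=
    hS₀.exists_first_hit hFc (disjoint_right.1 hd hgG) hfF
  obtain ⟨_, ⟨t', ht', rfl⟩, S₂, hS₂, hS₂', hS₂G⟩ :=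
    hS₁'.symm.exists_first_hit hGc (disjoint_left.1 hd (mem_image_of_mem f hs')) hgG
  have hS₂V : S₂ ⊆ V := hS₂.trans (hS₁.trans hS₀V)
  have hs0 : s' ≠ 0 := by
    rintro rfl
    obtain ⟨γ, -, rfl⟩ := hS₂'
    exact hf0 (hS₂V ⟨0, γ.source⟩)
  have ht0 : t' ≠ 0 := by
    rintro rfl
    obtain ⟨γ, -, rfl⟩ := hS₂'
    exact hg0 (hS₂V ⟨1, γ.target⟩)
  have hF' : f '' Icc 0 s' ⊆ f '' Icc 0 s := image_mono (Icc_subset_Icc_right hs'.2)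
  have hG' : g '' Icc 0 t' ⊆ g '' Icc 0 t := image_mono (Icc_subset_Icc_right ht'.2)
  refine ⟨f '' Icc 0 s' ∪ S₂ ∪ g '' Icc 0 t', ?_, ?_, s', t', hs0, hs'.2, ht0, ht'.2,
    subset_union_left.trans subset_union_left, subset_union_right⟩
  · rintro z ((hz | hz) | hz)
    · exact Or.inr (Or.inl (hF' hz))
    · exact Or.inl (hS₂V hz)
    · exact Or.inr (Or.inr (hG' hz))
  · refine ((IsArc.image_Icc hf hf' hs0).trans hS₂' ?_).trans (IsArc.image_Icc hg hg' ht0).symm ?_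
    · exact fun z hz => hS₁F ⟨hS₂ hz.2, hF' hz.1⟩
    · rintro z ⟨hz | hz, hz'⟩
      · exact (hd.le_bot ⟨hF' hz, hG' hz'⟩).elim
      · exact hS₂G ⟨hz, hG' hz'⟩

end NormedSpace

theorem exists_image_Icc_subset {X : Type*} [TopologicalSpace X] {f : unitInterval → X}
    (hf : Continuous f) {O : Set X} (hO : IsOpen O) (h0 : f 0 ∈ O) :
    ∃ t : unitInterval, t ≠ 0 ∧ t ≠ 1 ∧ f '' Icc 0 t ⊆ O := by
  obtain ⟨δ, hδ, hδO⟩ := Metric.isOpen_iff.1 (hO.preimage hf) 0 h0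
  have hpos : 0 < min (δ / 2) (1 / 2) := by positivity
  have hle : min (δ / 2) (1 / 2) ≤ 1 / 2 := min_le_right _ _
  refine ⟨⟨min (δ / 2) (1 / 2), hpos.le, by linarith⟩, ?_, ?_, ?_⟩
  · exact fun h => hpos.ne' (congrArg Subtype.val h)
  · intro h
    have : min (δ / 2) (1 / 2) = 1 := congrArg Subtype.val h
    linarith
  · rintro _ ⟨s, hs, rfl⟩
    apply hδO
    have h1 : (s : ℝ) ≤ min (δ / 2) (1 / 2) := hs.2
    have h2 := min_le_left (δ / 2) (1 / 2 : ℝ)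
    rw [mem_ball, Subtype.dist_eq, Set.Icc.coe_zero, Real.dist_0_eq_abs,
      abs_of_nonneg s.2.1]
    linarith

theorem IsEndCut.mem_frontier {U : Set Plane} {x : Plane} {φ : unitInterval → Plane}
    (h : IsEndCut U x φ) (hU : IsOpen U) (hx : x ∉ U) : x ∈ frontier U := by
  refine ⟨?_, by rwa [hU.interior_eq]⟩
  rw [← h.2.2.1, _root_.mem_closure_iff]
  intro O hO h0
  obtain ⟨t, ht, -, htO⟩ := exists_image_Icc_subset h.1 hO h0
  exact ⟨φ t, htO (mem_image_of_mem φ ⟨unitInterval.nonneg', le_rfl⟩), h.2.2.2 t ht⟩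

/-- **Theorem 2.1.** Let `K` be a simple set, `x ∈ K`, `ε > 0`, and let `y₁ ≠ y₂` be points
of `K(closure B(x,ε), x)` accessible from `W₁`, with end-cuts `α₁`, `α₂` of `W₁` at `y₁`,
`y₂`. Then for every `ε₁ > ε` there is a cross-cut `β` of `W₁` with end-points `y₁`, `y₂`
such that `β(I) ⊆ B(x,ε₁)` and `αᵢ([0,τᵢ]) ⊆ β(I)` for some `τ₁, τ₂ ∈ (0,1)`. -/
theorem exists_crossCut_of_accessible_pair (K W₁ W₂ : Set Plane)
    (h : IsSimpleSet K W₁ W₂) (x : Plane) (hx : x ∈ K) (ε : ℝ) (hε : 0 < ε)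
    (y₁ y₂ : Plane) (hy : y₁ ≠ y₂)
    (hy₁ : y₁ ∈ connectedComponentIn (K ∩ closedBall x ε) x)
    (hy₂ : y₂ ∈ connectedComponentIn (K ∩ closedBall x ε) x)
    (α₁ α₂ : unitInterval → Plane)
    (hα₁ : IsEndCut W₁ y₁ α₁) (hα₂ : IsEndCut W₁ y₂ α₂)
    (ε₁ : ℝ) (hε₁ : ε < ε₁) :
    ∃ β : unitInterval → Plane, IsCrossCut W₁ β ∧ β 0 = y₁ ∧ β 1 = y₂ ∧
      Set.range β ⊆ ball x ε₁ ∧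
      ∃ τ₁ τ₂ : unitInterval, τ₁ ≠ 0 ∧ τ₁ ≠ 1 ∧ τ₂ ≠ 0 ∧ τ₂ ≠ 1 ∧
        α₁ '' Set.Icc 0 τ₁ ⊆ Set.range β ∧ α₂ '' Set.Icc 0 τ₂ ⊆ Set.range β := by
  obtain ⟨⟨hK, hne, ⟨p₁, hp₁, hW₁⟩, ⟨p₂, hp₂, hW₂⟩, hall⟩, -, hacc⟩ := h
  have hKc : IsOpen Kᶜ := hK.isClosed.isOpen_compl
  have ho₁ : IsOpen W₁ := hW₁ ▸ hKc.connectedComponentIn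
  have ho₂ : IsOpen W₂ := hW₂ ▸ hKc.connectedComponentIn
  have hc₁ : IsPreconnected W₁ := hW₁ ▸ isPreconnected_connectedComponentIn
  have hc₂ : IsConnected W₂ := hW₂ ▸ isConnected_connectedComponentIn_iff.2 hp₂
  have hWK₁ : W₁ ⊆ Kᶜ := hW₁ ▸ connectedComponentIn_subset _ _
  have hWK₂ : W₂ ⊆ Kᶜ := hW₂ ▸ connectedComponentIn_subset _ _
  have hd : Disjoint W₁ W₂ := by
    rw [disjoint_left]
    intro z hz₁ hz₂
    rw [← hW₁] at hz₁
    rw [← hW₂] at hz₂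
    exact hne (hW₁ ▸ hW₂ ▸ (connectedComponentIn_eq hz₁).trans (connectedComponentIn_eq hz₂).symm)
  have hcl : W₁ᶜ ⊆ closure W₂ := by
    intro z hz
    by_cases hzK : z ∈ K
    · exact closure_minimal (fun w hw => hw.2.1.1) isClosed_closure (hacc hzK)
    · have hzc := mem_connectedComponentIn (F := Kᶜ) hzK
      rcases hall z hzK with h | h
      · exact (hz (h ▸ hzc)).elim
      · exact subset_closure (h ▸ hzc)
  set C := connectedComponentIn (K ∩ closedBall x ε) x
  have hCK : C ⊆ K ∩ closedBall x ε := connectedComponentIn_subset _ _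
  obtain ⟨ρ, hερ, hρε⟩ := exists_between hε₁
  have hCρ : C ⊆ ball x ρ := fun z hz => closedBall_subset_ball hερ (hCK hz).2
  obtain ⟨O₁, O₂, hO₁, hO₂, hyO₁, hyO₂, hO⟩ := t2_separation hy
  have hyW₁ : y₁ ∉ W₁ := fun h => hWK₁ h (hCK hy₁).1
  have hyW₂ : y₂ ∉ W₁ := fun h => hWK₁ h (hCK hy₂).1
  have hfr₁ := hα₁.mem_frontier ho₁ hyW₁
  have hfr₂ := hα₂.mem_frontier ho₁ hyW₂
  obtain ⟨hcα₁, hiα₁, rfl, hmα₁⟩ := hα₁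
  obtain ⟨hcα₂, hiα₂, rfl, hmα₂⟩ := hα₂
  obtain ⟨t₁, ht₁, ht₁', hs₁⟩ :=
    exists_image_Icc_subset hcα₁ (hO₁.inter isOpen_ball) ⟨hyO₁, hCρ hy₁⟩
  obtain ⟨t₂, ht₂, ht₂', hs₂⟩ :=
    exists_image_Icc_subset hcα₂ (hO₂.inter isOpen_ball) ⟨hyO₂, hCρ hy₂⟩
  have hαW : ∀ α : unitInterval → Plane, (∀ t, t ≠ 0 → α t ∈ W₁) → α 0 ∈ C →
      ∀ t, Disjoint (α '' Icc 0 t) W₂ := by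
    intro α hα hα0 t
    rw [disjoint_left]
    rintro _ ⟨u, -, rfl⟩ hu
    rcases eq_or_ne u 0 with rfl | hu0
    · exact hWK₂ hu (hCK hα0).1
    · exact disjoint_left.1 hd (hα u hu0) hu
  have h0 : ∀ t : unitInterval, (0 : unitInterval) ∈ Icc 0 t :=
    fun t => ⟨le_rfl, unitInterval.nonneg'⟩
  have hlast : ∀ t : unitInterval, t ∈ Icc 0 t := fun t => ⟨unitInterval.nonneg', le_rfl⟩
  have hmem : α₂ t₂ ∈ connectedComponentIn (W₁ ∩ ball x ε₁) (α₁ t₁) := by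
    refine Plane.mem_connectedComponentIn_inter_ball (T := α₁ '' Icc 0 t₁ ∪ C ∪ α₂ '' Icc 0 t₂)
      (r := ρ) ho₁ ho₂ hc₁ hc₂ hd hcl ?_ ?_ (hε.trans hερ) hρε ?_
      (Or.inl (Or.inl (mem_image_of_mem _ (hlast _)))) (Or.inr (mem_image_of_mem _ (hlast _)))
      (hmα₁ _ ht₁) (hmα₂ _ ht₂)
    · exact ((isPreconnected_Icc.image _ hcα₁.continuousOn).union (α₁ 0)
        (mem_image_of_mem _ (h0 _)) hy₁ isPreconnected_connectedComponentIn).union (α₂ 0)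
        (Or.inr hy₂) (mem_image_of_mem _ (h0 _)) (isPreconnected_Icc.image _ hcα₂.continuousOn)
    · exact ((hαW α₁ hmα₁ hy₁ _).union_left
        (disjoint_left.2 fun z hz hz' => hWK₂ hz' (hCK hz).1)).union_left (hαW α₂ hmα₂ hy₂ _)
    · exact union_subset (union_subset (hs₁.trans inter_subset_right) hCρ)
        (hs₂.trans inter_subset_right)
  have hVsub := connectedComponentIn_subset (W₁ ∩ ball x ε₁) (α₁ t₁)
  have hρ : ball x ρ ⊆ ball x ε₁ := ball_subset_ball hρε.le
  obtain ⟨S, hSV, ⟨β, hβ, rfl⟩, τ₁, τ₂, hτ₁, hτ₁', hτ₂, hτ₂', hα₁β, hα₂β⟩ :=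
    exists_isArc_of_endpoints_mem (ho₁.inter isOpen_ball).connectedComponentIn
      isPreconnected_connectedComponentIn hcα₁ hiα₁ hcα₂ hiα₂
      (hO.mono (hs₁.trans inter_subset_left) (hs₂.trans inter_subset_left))
      (mem_connectedComponentIn ⟨hmα₁ _ ht₁,
        hρ (hs₁ (mem_image_of_mem _ (hlast _))).2⟩) hmem
      (fun h => hyW₁ (hVsub h).1) (fun h => hyW₂ (hVsub h).1)
  have hlt : ∀ s t : unitInterval, s ≤ t → t ≠ 1 → s ≠ 1 := by
    rintro s t hst ht rfl
    exact ht (le_antisymm unitInterval.le_one' hst)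
  refine ⟨β, ⟨β.continuous, hβ, by rwa [β.source], by rwa [β.target], fun t h0 h1 => ?_⟩,
    β.source, β.target, ?_, τ₁, τ₂, hτ₁, hlt _ _ hτ₁' ht₁', hτ₂, hlt _ _ hτ₂' ht₂', hα₁β, hα₂β⟩
  · rcases hSV (mem_range_self t) with h | ⟨u, -, hu⟩ | ⟨u, -, hu⟩
    · exact (hVsub h).1
    · rw [← hu]
      refine hmα₁ u ?_
      rintro rfl
      exact h0 (hβ (hu.symm.trans β.source.symm))
    · rw [← hu]
      refine hmα₂ u ?_
      rintro rfl
      exact h1 (hβ (hu.symm.trans β.target.symm))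
  · refine hSV.trans (union_subset (hVsub.trans inter_subset_right) (union_subset ?_ ?_))
    · exact (hs₁.trans inter_subset_right).trans hρ
    · exact (hs₂.trans inter_subset_right).trans hρ
end
end

section
/- Let F ⊆ ℝ² be a compact connected set, let x ∈ F, and let X be a closed neighborhood of x (a closed set containing x in its interior) such that F \ X is nonempty. Then the connected component of x in F ∩ X meets the frontier of X. -/
open Set Metric Topology

noncomputable section

/-- In a compact Hausdorff space, the clopen neighborhoods of a point form a neighborhood basis
of its connected component. -/
theorem exists_isClopen_subset_of_connectedComponent_subset {Y : Type*} [TopologicalSpace Y]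
    [T2Space Y] [CompactSpace Y] {x : Y} {U : Set Y} (hU : IsOpen U)
    (hxU : connectedComponent x ⊆ U) : ∃ S : Set Y, IsClopen S ∧ x ∈ S ∧ S ⊆ U := by
  have : Nonempty {s : Set Y // IsClopen s ∧ x ∈ s} := ⟨⟨univ, isClopen_univ, mem_univ x⟩⟩
  have hdir : Directed (· ⊇ ·) fun s : {s : Set Y // IsClopen s ∧ x ∈ s} => (s : Set Y) :=
    fun s t => ⟨⟨s ∩ t, s.2.1.inter t.2.1, s.2.2, t.2.2⟩, inter_subset_left, inter_subset_right⟩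
  obtain ⟨S, hS⟩ := exists_subset_nhds_of_isCompact hdir (fun s => s.2.1.1.isCompact)
    (fun y hy => hU.mem_nhds (hxU (connectedComponent_eq_iInter_isClopen x ▸ hy)))
  exact ⟨S, S.2.1, S.2.2, hS⟩

/-- Boundary bumping: if a compact connected set `F` in a Hausdorff space is not contained in a
closed neighborhood `X` of `x ∈ F`, then the component of `x` in `F ∩ X` meets the frontier
of `X`. -/
theorem IsCompact.connectedComponentIn_inter_frontier_nonempty {Y : Type*} [TopologicalSpace Y]
    [T2Space Y] {F X : Set Y} {x : Y} (hFc : IsCompact F) (hFconn : IsPreconnected F)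
    (hx : x ∈ F) (hXcl : IsClosed X) (hxX : x ∈ interior X) (hne : (F \ X).Nonempty) :
    (connectedComponentIn (F ∩ X) x ∩ frontier X).Nonempty := by
  by_contra hempty
  have hxK : x ∈ F ∩ X := ⟨hx, interior_subset hxX⟩
  have : CompactSpace ↥(F ∩ X) := isCompact_iff_compactSpace.mp (hFc.inter_right hXcl)
  have hsub : connectedComponent (⟨x, hxK⟩ : ↥(F ∩ X)) ⊆ (↑) ⁻¹' interior X := by
    intro y hy
    by_contra hyX
    refine hempty ⟨y, ?_, ?_⟩
    · rw [connectedComponentIn_eq_image hxK]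
      exact mem_image_of_mem _ hy
    · rw [hXcl.frontier_eq]
      exact ⟨y.2.2, hyX⟩
  obtain ⟨S, hS, hxS, hSX⟩ := exists_isClopen_subset_of_connectedComponent_subset
    (isOpen_interior.preimage continuous_subtype_val) hsub
  obtain ⟨O, hO, rfl⟩ := isOpen_induced_iff.mp hS.isOpen
  have hcl : IsClosed ((↑) '' ((↑) ⁻¹' O : Set ↥(F ∩ X)) : Set Y) :=
    (hS.isClosed.isCompact.image continuous_subtype_val).isClosed
  obtain ⟨z, hzF, hzX⟩ := hne
  obtain ⟨_, -, ⟨y, hyO, rfl⟩, hy⟩ := isPreconnected_closed_iff.mp hFconn _ _ hcl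
    (hO.inter isOpen_interior).isClosed_compl
    (fun y hy => or_iff_not_imp_right.mpr fun h =>
      have h := not_not.mp h
      ⟨⟨y, hy, interior_subset h.2⟩, h.1, rfl⟩)
    ⟨x, hx, ⟨x, hxK⟩, hxS, rfl⟩ ⟨z, hzF, fun h => hzX (interior_subset h.2)⟩
  exact hy ⟨hyO, hSX hyO⟩

/-- **Lemma 1.1.** Let `F` be a compact connected subset of the plane and `X` a closed
neighborhood of a point `x ∈ F` such that `F \ X ≠ ∅`. Then the connected component of
`x` in `F ∩ X` meets the frontier of `X`. -/
theorem component_meets_frontier (F : Set Plane) (hFc : IsCompact F)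
    (hFconn : IsConnected F) (x : Plane) (hx : x ∈ F)
    (X : Set Plane) (hXcl : IsClosed X) (hxX : x ∈ interior X)
    (hne : (F \ X).Nonempty) :
    (connectedComponentIn (F ∩ X) x ∩ frontier X).Nonempty := by
  exact hFc.connectedComponentIn_inter_frontier_nonempty hFconn.isPreconnected hx hXcl hxX hne
end
end

section
/- Let K ⊆ ℝ² be a simple set, i.e. a compact set whose complement has exactly two connected components W₁ and W₂ such that the sets A₁ and A₂ of points of K accessible from W₁ and from W₂ are each dense in K. Then for every proper closed subset K̃ ⊊ K, the complement ℝ² \ K̃ is connected. -/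
open Set Metric Topology

noncomputable section

/-- **Lemma 2.2.** Let `K` be a simple set in the plane. For every proper closed subset
`K̃ ⊊ K`, the complement `ℝ² \ K̃` is connected. -/
theorem compl_of_proper_closed_subset_connected (K W₁ W₂ : Set Plane)
    (h : IsSimpleSet K W₁ W₂) (K' : Set Plane) (hsub : K' ⊆ K) (hne : K' ≠ K)
    (hcl : IsClosed K') :
    IsConnected K'ᶜ := by
  obtain ⟨⟨-, -, ⟨x₁, hx₁, rfl⟩, ⟨x₂, hx₂, rfl⟩, hcover⟩, hd₁, hd₂⟩ := h
  obtain ⟨x, hxK, hxK'⟩ := exists_of_ssubset (hsub.ssubset_of_ne hne)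
  have hunion (z : Plane) (hz : z ∈ Kᶜ) (hd : K ⊆ closure (AccPts K (connectedComponentIn Kᶜ z))) :
      IsConnected (connectedComponentIn Kᶜ z ∪ K \ K') :=
    (isConnected_connectedComponentIn_iff.2 hz).subset_closure subset_union_left <|
      union_subset subset_closure fun y hy =>
        closure_minimal (fun _ hw => frontier_subset_closure hw.2.1) isClosed_closure (hd hy.1)
  convert IsConnected.union ⟨x, .inr ⟨hxK, hxK'⟩, .inr ⟨hxK, hxK'⟩⟩
    (hunion x₁ hx₁ hd₁) (hunion x₂ hx₂ hd₂) using 1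
  refine Subset.antisymm (fun y hy => ?_) ?_
  · by_cases hyK : y ∈ K
    · exact .inl (.inr ⟨hyK, hy⟩)
    · rcases hcover y hyK with hc | hc
      · exact .inl (.inl (hc ▸ mem_connectedComponentIn hyK))
      · exact .inr (.inl (hc ▸ mem_connectedComponentIn hyK))
  · have hcomp (z : Plane) : connectedComponentIn Kᶜ z ∪ K \ K' ⊆ K'ᶜ :=
      union_subset ((connectedComponentIn_subset _ _).trans (compl_subset_compl.2 hsub))
        fun _ hy => hy.2
    exact union_subset (hcomp x₁) (hcomp x₂)
end
end

section
/- Let K ⊆ ℝ² be a d-set with complementary domains W₁, W₂ and accessible-point sets A₁, A₂. Then for every x ∈ K and every open neighborhood U of x, the sets A₁ and A₂ are each dense in the connected component K(U,x) of x in K ∩ U. In particular, A₁ and A₂ are dense in K, i.e. every d-set is a simple set. -/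
open Set Metric Topology

noncomputable section

/-- A sufficiently dense set is dense in every component of every relatively open subset. -/
theorem SuffDense.connectedComponentIn_subset_closure {F R : Set Plane} (h : SuffDense F R)
    {U : Set Plane} (hU : IsOpen U) (x : Plane) :
    connectedComponentIn (F ∩ U) x ⊆ closure (connectedComponentIn (F ∩ U) x ∩ R) := by
  intro y hy
  have hyFU : y ∈ F ∩ U := connectedComponentIn_subset _ _ hy
  rw [connectedComponentIn_eq hy, _root_.mem_closure_iff]
  intro V hV hyV
  obtain ⟨z, hz, hzR⟩ := h y hyFU.1 (U ∩ V) (hU.inter hV) ⟨hyFU.2, hyV⟩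
  refine ⟨z, (connectedComponentIn_subset _ _ hz).2.2, ?_, hzR⟩
  exact connectedComponentIn_mono y (inter_subset_inter_right F inter_subset_left) hz

/-- A sufficiently dense subset is dense. -/
theorem SuffDense.subset_closure {F R : Set Plane} (h : SuffDense F R) : F ⊆ closure R := by
  intro x hx
  have hx' : x ∈ F ∩ univ := ⟨hx, mem_univ x⟩
  exact closure_mono inter_subset_right
    (h.connectedComponentIn_subset_closure isOpen_univ x (mem_connectedComponentIn hx'))

/-- **Proposition 1.2.** Let `K` be a d-set. For any `x ∈ K` and open neighborhood `U`
of `x`, the sets `A₁` and `A₂` are dense in `K(U,x)`. In particular, `A₁` and `A₂` are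
dense in `K`, i.e. every d-set is a simple set. -/
theorem dSet_accPts_dense_in_components (K W₁ W₂ : Set Plane) (h : IsDSet K W₁ W₂) :
    (∀ x ∈ K, ∀ U : Set Plane, IsOpen U → x ∈ U →
      connectedComponentIn (K ∩ U) x ⊆
        closure (connectedComponentIn (K ∩ U) x ∩ AccPts K W₁) ∧
      connectedComponentIn (K ∩ U) x ⊆
        closure (connectedComponentIn (K ∩ U) x ∩ AccPts K W₂)) ∧
    IsSimpleSet K W₁ W₂ := by
  obtain ⟨hK, h₁, h₂⟩ := h
  exact ⟨fun x _ U hU _ => ⟨h₁.connectedComponentIn_subset_closure hU x,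
    h₂.connectedComponentIn_subset_closure hU x⟩, hK, h₁.subset_closure, h₂.subset_closure⟩
end
end

section
/- Every simple set in the plane is connected. That is, if K ⊆ ℝ² is a compact set whose complement has exactly two connected components W₁ and W₂, and the sets A₁ and A₂ of points of K accessible from W₁ and from W₂ are each dense in K, then K is connected. -/
open Set Metric Topology

noncomputable section

/-- A lift of a circle-valued function restricts, on a connected set, to a constant translate of
any real representative of that function. -/
theorem IsPreconnected.sub_eq_sub_of_coe_eq {X : Type*} [TopologicalSpace X] {S : Set X}
    (hS : IsPreconnected S) {p : ℝ} {f g : X → ℝ} (hf : Continuous f) (hg : Continuous g)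
    (h : ∀ x ∈ S, (f x : AddCircle p) = g x) {x y : X} (hx : x ∈ S) (hy : y ∈ S) :
    f x - g x = f y - g y := by
  have hT : IsDiscrete (AddSubgroup.zmultiples p : Set ℝ) :=
    ⟨inferInstanceAs (DiscreteTopology (AddSubgroup.zmultiples p))⟩
  refine hS.constant_of_mapsTo hT (hf.sub hg).continuousOn (fun z hz ↦ ?_) hx hy
  have := (QuotientAddGroup.eq (s := AddSubgroup.zmultiples p)).1 (h z hz).symm
  simpa [sub_eq_neg_add] using this

/-- In a simply connected, locally path connected normal space, the common boundary of two
disjoint connected open sets which together with it fill the space is connected. -/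
theorem isPreconnected_of_subset_closure_inter_closure {X : Type*} [TopologicalSpace X]
    [SimplyConnectedSpace X] [LocallyPathConnectedSpace X] [NormalSpace X] {K U V : Set X}
    (hK : IsClosed K) (hU : IsOpen U) (hV : IsOpen V) (hUc : IsPreconnected U)
    (hVc : IsPreconnected V) (hUV : Disjoint U V) (hcover : Kᶜ ⊆ U ∪ V)
    (hKU : K ⊆ closure U) (hKV : K ⊆ closure V) : IsPreconnected K := by
  classical
  rw [isPreconnected_iff_subset_of_fully_disjoint_closed hK]
  intro A B hA hB hKAB hAB
  by_contra! hcon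
  obtain ⟨b, hbK, hbA⟩ := Set.not_subset.1 hcon.1
  obtain ⟨a, haK, haB⟩ := Set.not_subset.1 hcon.2
  have haA : a ∈ A := (hKAB haK).resolve_right haB
  have hbB : b ∈ B := (hKAB hbK).resolve_left hbA
  obtain ⟨u, hu0, hu1, -⟩ := exists_continuous_zero_one_of_isClosed hA hB hAB
  have huK : ∀ x ∈ K, ((u x : ℝ) : AddCircle (2 : ℝ)) = ((-u x : ℝ) : AddCircle (2 : ℝ)) := by
    intro x hx
    rcases hKAB hx with h | h
    · simp [hu0 h]
    · rw [hu1 h, Pi.one_apply, QuotientAddGroup.eq]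
      exact ⟨-1, by norm_num⟩
  have hUV' : ∀ x ∈ closure V, x ∉ U := fun x hx hxU ↦
    Set.disjoint_left.1 (hUV.closure_right hU) hxU hx
  have hU' : ∀ x ∈ closure U, x ∉ U → x ∈ K := by
    intro x hx hxU
    by_contra hxK
    exact Set.disjoint_left.1 (hUV.closure_left hV) hx ((hcover hxK).resolve_left hxU)
  let g : X → AddCircle (2 : ℝ) := fun x ↦ if x ∈ U then (u x : ℝ) else (-u x : ℝ)
  have hg : Continuous g := by
    refine Continuous.if (fun x hx ↦ huK x ?_)
      (continuous_quotient_mk'.comp u.continuous)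
      (continuous_quotient_mk'.comp u.continuous.neg)
    exact hU' x hx.1 fun h ↦ hx.2 (by rwa [Set.ofPred_mem_eq, hU.interior_eq])
  obtain ⟨e, he⟩ := QuotientAddGroup.mk_surjective (g a)
  obtain ⟨F, ⟨-, hF⟩, -⟩ := (AddCircle.isCoveringMap_coe (2 : ℝ)).existsUnique_continuousMap_lifts
    ⟨g, hg⟩ a e he
  replace hF : ∀ x, ((F x : ℝ) : AddCircle (2 : ℝ)) = g x := fun x ↦ congrFun hF x
  have h1 := hUc.closure.sub_eq_sub_of_coe_eq F.continuous u.continuous (p := 2)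
    (fun x hx ↦ by
      rw [hF]
      by_cases hxU : x ∈ U
      · simp [g, hxU]
      · simpa [g, hxU] using (huK x (hU' x hx hxU)).symm) (hKU haK) (hKU hbK)
  have h2 := hVc.closure.sub_eq_sub_of_coe_eq F.continuous u.continuous.neg (p := 2)
    (fun x hx ↦ by simp [hF, g, hUV' x hx]) (hKV haK) (hKV hbK)
  have ha0 : u a = 0 := hu0 haA
  have hb1 : u b = 1 := hu1 hbB
  simp only [Pi.neg_apply, ha0, hb1] at h1 h2
  linarith

/-- **Proposition 1.4.** Every simple set in the plane is connected. -/
theorem simpleSet_isConnected (K W₁ W₂ : Set Plane) (h : IsSimpleSet K W₁ W₂) :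
    IsConnected K := by
  obtain ⟨⟨hK, hne, ⟨x₁, hx₁, rfl⟩, ⟨x₂, hx₂, rfl⟩, hcomp⟩, h₁, h₂⟩ := h
  refine ⟨?_, ?_⟩
  · by_contra hempty
    rw [Set.not_nonempty_iff_eq_empty] at hempty
    subst hempty
    exact hne (by simp [connectedComponentIn_univ])
  have hacc : ∀ W : Set Plane, K ⊆ closure (AccPts K W) → K ⊆ closure W := fun W hW ↦
    hW.trans (closure_minimal (fun x hx ↦ frontier_subset_closure hx.2.1) isClosed_closure)
  refine isPreconnected_of_subset_closure_inter_closure hK.isClosed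
    hK.isClosed.isOpen_compl.connectedComponentIn hK.isClosed.isOpen_compl.connectedComponentIn
    isPreconnected_connectedComponentIn isPreconnected_connectedComponentIn
    (Set.disjoint_left.2 fun x h h' ↦
      hne ((connectedComponentIn_eq h).trans (connectedComponentIn_eq h').symm)) (fun x hx ↦ ?_)
    (hacc _ h₁) (hacc _ h₂)
  have hxx := mem_connectedComponentIn hx
  rcases hcomp x hx with h | h <;> rw [h] at hxx
  exacts [Or.inl hxx, Or.inr hxx]
end
end
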